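/- arXiv:1904.04682 — 4 statements merged into one kernel-verified Lean document; each statement's English description precedes it below -/
import Mathlib

section
/- Let n ≥ 3 and let D = (V,E,w) be a vertex-weighted oriented cycle on vertices x_1,...,x_n with edges (x_1,x_2), (x_2,x_3), ..., (x_{n−1},x_n), (x_n,x_1), and suppose w(x) ≥ 2 for every vertex x. Then pd(I(D)) = |E| − 1. -/
open MvPolynomial

noncomputable section

namespace WOG

variable {k : Type} [Field k]

/-- The maximal graded ideal `(x : x ∈ V)` of the polynomial ring. -/
def mIdeal (k V : Type) [Field k] : Ideal (MvPolynomial V k) :=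
  Ideal.span (Set.range (X : V → MvPolynomial V k))

/-- The edge ideal `I(D) = (x * y^{w(y)} : (x,y) ∈ E)` of a vertex-weighted
oriented graph `D = (V, E, w)`. -/
def edgeIdeal (k : Type) [Field k] {V : Type} (E : Set (V × V)) (w : V → ℕ) :
    Ideal (MvPolynomial V k) :=
  Ideal.span {p : MvPolynomial V k | ∃ e ∈ E, p = X e.1 * X e.2 ^ w e.2}

/-- A minimal graded free resolution `⋯ → F₁ → F₀ → I → 0` of an ideal
`I` of the polynomial ring `S = k[x : x ∈ V]`, where `Fᵢ` is the graded free
module with (finite) homogeneous basis `ι i` whose element `a` sits in degree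
`deg i a` (i.e. `Fᵢ = ⊕_a S(- deg i a)`), the maps are graded (degree-preserving)
`S`-linear maps, the complex is exact, and all the matrix entries of the
differentials lie in the maximal graded ideal `𝔪 = (x : x ∈ V)` (minimality). -/
structure MinFreeRes {V : Type} (I : Ideal (MvPolynomial V k)) where
  ι : ℕ → Type
  finite : ∀ i, Finite (ι i)
  deg : ∀ i, ι i → ℕ
  aug : ((ι 0) →₀ MvPolynomial V k) →ₗ[MvPolynomial V k] MvPolynomial V k
  d : ∀ i, ((ι (i + 1)) →₀ MvPolynomial V k) →ₗ[MvPolynomial V k] ((ι i) →₀ MvPolynomial V k)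
  aug_range : LinearMap.range aug = I
  exact_zero : LinearMap.range (d 0) = LinearMap.ker aug
  exact_succ : ∀ i, LinearMap.range (d (i + 1)) = LinearMap.ker (d i)
  aug_homog : ∀ a, (aug (Finsupp.single a 1)).IsHomogeneous (deg 0 a)
  d_homog : ∀ i a b, (d i (Finsupp.single a 1)) b = 0 ∨
      ∃ e, deg (i + 1) a = deg i b + e ∧ ((d i (Finsupp.single a 1)) b).IsHomogeneous e
  minimal : ∀ i a b, (d i (Finsupp.single a 1)) b ∈ mIdeal k V

/-- The graded Betti number `β_{i,j}(I)`, read off from a minimal graded free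
resolution: the number of basis elements of `Fᵢ` of degree `j`. -/
def MinFreeRes.betti {V : Type} {I : Ideal (MvPolynomial V k)} (R : MinFreeRes I)
    (i j : ℕ) : ℕ :=
  Nat.card {a : R.ι i // R.deg i a = j}

/-- The set `{j - i : β_{i,j}(I) ≠ 0}`; its greatest element is the
Castelnuovo–Mumford regularity `reg I`. -/
def MinFreeRes.regSet {V : Type} {I : Ideal (MvPolynomial V k)} (R : MinFreeRes I) :
    Set ℤ :=
  {t : ℤ | ∃ i j : ℕ, R.betti i j ≠ 0 ∧ t = (j : ℤ) - (i : ℤ)}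

/-- The set `{i : β_{i,j}(I) ≠ 0 for some j}`; its greatest element is the
projective dimension `pd I`. -/
def MinFreeRes.pdSet {V : Type} {I : Ideal (MvPolynomial V k)} (R : MinFreeRes I) :
    Set ℕ :=
  {i : ℕ | ∃ j : ℕ, R.betti i j ≠ 0}

/-- The set of lengths of `I`-regular sequences contained in the maximal graded
ideal `𝔪 = (x : x ∈ V)`; its greatest element is `depth I`. -/
def depthSet (k : Type) [Field k] {V : Type} (I : Ideal (MvPolynomial V k)) : Set ℕ :=
  {n : ℕ | ∃ rs : List (MvPolynomial V k), rs.length = n ∧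
    (∀ r ∈ rs, r ∈ mIdeal k V) ∧ RingTheory.Sequence.IsRegular (↥I) rs}

end WOG

namespace WOG

section Koszul

variable {A V : Type} [CommRing A] {ι : ℕ → Type}

/-- The ideal generated by the variables in `s`. -/
def varIdeal (A : Type) [CommRing A] {V : Type} (s : Finset V) : Ideal (MvPolynomial V A) :=
  Ideal.span (X '' (s : Set V))

lemma varIdeal_insert [DecidableEq V] (a : V) (s : Finset V) :
    varIdeal A (insert a s) = Ideal.span {X a} ⊔ varIdeal A s := by
  rw [varIdeal, Finset.coe_insert, Set.image_insert_eq, Ideal.span_insert, varIdeal]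

lemma mem_varIdeal_of_X_mul_mem {a : V} {s : Finset V} (ha : a ∉ s) {p : MvPolynomial V A}
    (h : X a * p ∈ varIdeal A s) : p ∈ varIdeal A s := by
  classical
  rw [varIdeal, mem_ideal_span_X_image] at h ⊢
  intro m hm
  obtain ⟨i, hi, hmi⟩ := h (Finsupp.single a 1 + m) (by
    rw [mem_support_iff, coeff_X_mul]
    exact mem_support_iff.mp hm)
  refine ⟨i, hi, ?_⟩
  have hne : a ≠ i := fun h => ha (by simpa [h] using hi)
  simpa [Finsupp.single_apply, hne] using hmi

/-- The submodule `I • F` of the free module `F` with basis `κ`. -/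
abbrev idealFree {R : Type} [CommRing R] (I : Ideal R) (κ : Type) : Submodule R (κ →₀ R) :=
  I • ⊤

lemma mem_idealFree_iff {R κ : Type} [CommRing R] (I : Ideal R) (z : κ →₀ R) :
    z ∈ idealFree I κ ↔ ∀ b, z b ∈ I := by
  constructor
  · intro h b
    have : z b ∈ I • (⊤ : Submodule R R) :=
      Submodule.smul_top_le_comap_smul_top I (Finsupp.lapply b) h
    simpa using this
  · intro h
    rw [← Finsupp.sum_single z]
    refine Submodule.sum_mem _ fun b _ => ?_
    rw [← mul_one (z b), ← smul_eq_mul, ← Finsupp.smul_single]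
    exact Submodule.smul_mem_smul (h b) trivial

lemma mem_idealFree_varIdeal_empty {κ : Type} {z : κ →₀ MvPolynomial V A} :
    z ∈ idealFree (varIdeal A ∅) κ ↔ z = 0 := by
  simp [varIdeal]

lemma mem_varIdeal_free_of_X_smul_mem {κ : Type} {a : V} {s : Finset V} (ha : a ∉ s)
    {z : κ →₀ MvPolynomial V A}
    (h : (X a : MvPolynomial V A) • z ∈ idealFree (varIdeal A s) κ) :
    z ∈ idealFree (varIdeal A s) κ := by
  rw [mem_idealFree_iff] at h ⊢
  exact fun b => mem_varIdeal_of_X_mul_mem ha (h b)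

lemma exists_of_mem_varIdeal_insert_free [DecidableEq V] {κ : Type} {a : V} {s : Finset V}
    {z : κ →₀ MvPolynomial V A} (h : z ∈ idealFree (varIdeal A (insert a s)) κ) :
    ∃ q, z - (X a : MvPolynomial V A) • q ∈ idealFree (varIdeal A s) κ := by
  rw [varIdeal_insert, idealFree, Submodule.sup_smul, Submodule.ideal_span_singleton_smul] at h
  obtain ⟨y, hy, r, hr, rfl⟩ := Submodule.mem_sup.mp h
  obtain ⟨q, -, rfl⟩ := (Submodule.mem_smul_pointwise_iff_exists _ _ _).mp hy
  exact ⟨q, by simpa using hr⟩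

lemma varIdeal_free_le_insert [DecidableEq V] {κ : Type} (a : V) (s : Finset V) :
    idealFree (varIdeal A s) κ ≤ idealFree (varIdeal A (insert a s)) κ := by
  rw [varIdeal_insert]
  exact Submodule.smul_mono_left le_sup_right

lemma X_smul_mem_varIdeal_insert_free [DecidableEq V] {κ : Type} (a : V) (s : Finset V)
    (z : κ →₀ MvPolynomial V A) :
    (X a : MvPolynomial V A) • z ∈ idealFree (varIdeal A (insert a s)) κ := by
  refine Submodule.smul_mem_smul (Ideal.subset_span ⟨a, ?_, rfl⟩) trivial
  simp

lemma map_mem_idealFree {R α β : Type} [CommRing R] {I : Ideal R} (f : (α →₀ R) →ₗ[R] (β →₀ R))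
    {z : α →₀ R} (h : z ∈ idealFree I α) : f z ∈ idealFree I β :=
  Submodule.smul_top_le_comap_smul_top I f h

variable (d : ∀ i, (ι (i + 1) →₀ MvPolynomial V A) →ₗ[MvPolynomial V A]
  (ι i →₀ MvPolynomial V A))

/-- A complex of free modules that is acyclic in positive degrees becomes, modulo the variables
in `s`, acyclic in degrees larger than `s.card`. -/
lemma acyclic_mod_varIdeal (hd : ∀ i, LinearMap.range (d (i + 1)) = LinearMap.ker (d i))
    (s : Finset V) : ∀ (i : ℕ) (y : ι (i + 1) →₀ MvPolynomial V A), s.card ≤ i →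
      d i y ∈ idealFree (varIdeal A s) (ι i) →
      ∃ u, y - d (i + 1) u ∈ idealFree (varIdeal A s) (ι (i + 1)) := by
  classical
  have hdd : ∀ i y, d i (d (i + 1) y) = 0 := fun i y =>
    LinearMap.mem_ker.mp (hd i ▸ LinearMap.mem_range_self _ y)
  induction s using Finset.induction_on with
  | empty =>
    intro i y _ hy
    have hy' : y ∈ LinearMap.range (d (i + 1)) := by
      rw [hd i, LinearMap.mem_ker]
      exact mem_idealFree_varIdeal_empty.mp hy
    obtain ⟨u, rfl⟩ := hy'
    exact ⟨u, by simp⟩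
  | insert a s ha ih =>
    intro i y hi hy
    rw [Finset.card_insert_of_notMem ha] at hi
    obtain ⟨i, rfl⟩ : ∃ i', i = i' + 1 := ⟨i - 1, by omega⟩
    obtain ⟨z, hz⟩ := exists_of_mem_varIdeal_insert_free hy
    have hdz : d i z ∈ idealFree (varIdeal A s) (ι i) := by
      refine mem_varIdeal_free_of_X_smul_mem ha ?_
      have := map_mem_idealFree (d i) hz
      rw [map_sub, hdd, map_smul, zero_sub] at this
      exact neg_mem_iff.mp this
    obtain ⟨u, hu⟩ := ih i z (by omega) hdz
    obtain ⟨v, hv⟩ := ih (i + 1) (y - (X a : MvPolynomial V A) • u) (by omega) (by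
      have := add_mem hz (Submodule.smul_mem _ (X a : MvPolynomial V A) hu)
      rw [map_sub, map_smul]
      convert this using 1
      rw [smul_sub]
      abel)
    refine ⟨v, ?_⟩
    have := add_mem (varIdeal_free_le_insert a s hv)
      (X_smul_mem_varIdeal_insert_free a s u)
    convert this using 1
    abel

/-- A nonzero socle element of the zeroth homology lifts to a nonzero socle element of the
homology in degree `s.card` modulo the variables in `s`. -/
lemma exists_socle_mod_varIdeal (hd : ∀ i, LinearMap.range (d (i + 1)) = LinearMap.ker (d i))
    {f : ι 0 →₀ MvPolynomial V A} (hf : f ∉ LinearMap.range (d 0))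
    (hXf : ∀ l, (X l : MvPolynomial V A) • f ∈ LinearMap.range (d 0)) (s : Finset V) :
    ∀ j, s.card = j → ∃ y : ι j →₀ MvPolynomial V A,
      (∀ u, y - d j u ∉ idealFree (varIdeal A s) (ι j)) ∧
      ∀ l, ∃ u, (X l : MvPolynomial V A) • y - d j u ∈ idealFree (varIdeal A s) (ι j) := by
  classical
  induction s using Finset.induction_on with
  | empty =>
    rintro _ rfl
    refine ⟨f, fun u hu => hf ⟨u, ?_⟩, fun l => ?_⟩
    · exact (sub_eq_zero.mp (mem_idealFree_varIdeal_empty.mp hu)).symm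
    · obtain ⟨u, hu⟩ := hXf l
      exact ⟨u, (sub_eq_zero.mpr hu.symm).symm ▸ Submodule.zero_mem _⟩
  | insert a s ha ih =>
    intro j hj
    rw [Finset.card_insert_of_notMem ha] at hj
    subst hj
    obtain ⟨y, hy, hXy⟩ := ih _ rfl
    obtain ⟨u, hu⟩ := hXy a
    have hdd : ∀ i y, d i (d (i + 1) y) = 0 := fun i y =>
      LinearMap.mem_ker.mp (hd i ▸ LinearMap.mem_range_self _ y)
    refine ⟨u, fun v hv => ?_, fun l => ?_⟩
    · obtain ⟨t, ht⟩ := exists_of_mem_varIdeal_insert_free hv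
      refine hy t (mem_varIdeal_free_of_X_smul_mem ha ?_)
      have := add_mem hu (map_mem_idealFree (d s.card) ht)
      rw [map_sub, map_sub, hdd, map_smul] at this
      convert this using 1
      rw [smul_sub]
      abel
    · obtain ⟨t, ht⟩ := hXy l
      obtain ⟨v, hv⟩ := acyclic_mod_varIdeal d hd s s.card
        ((X l : MvPolynomial V A) • u - (X a : MvPolynomial V A) • t) le_rfl (by
          have := sub_mem (Submodule.smul_mem _ (X a : MvPolynomial V A) ht)
            (Submodule.smul_mem _ (X l : MvPolynomial V A) hu)
          rw [map_sub, map_smul, map_smul]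
          convert this using 1
          rw [smul_sub, smul_sub, smul_comm (X a : MvPolynomial V A) (X l)]
          abel)
      refine ⟨v, ?_⟩
      have := add_mem (varIdeal_free_le_insert a s hv)
        (X_smul_mem_varIdeal_insert_free a s t)
      convert this using 1
      abel

end Koszul

variable {k : Type} [Field k]

section Resolution

variable {V : Type} {I : Ideal (MvPolynomial V k)}

lemma varIdeal_univ [Fintype V] : varIdeal k (Finset.univ : Finset V) = mIdeal k V := by
  simp [varIdeal, mIdeal]

lemma one_notMem_mIdeal : (1 : MvPolynomial V k) ∉ mIdeal k V := by
  rw [mIdeal, ← Set.image_univ, mem_ideal_span_X_image]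
  simp

/-- The index types of the free resolution of `S ⧸ I` extending a free resolution of `I`. -/
abbrev MinFreeRes.extIdx (R : MinFreeRes I) : ℕ → Type
  | 0 => Unit
  | i + 1 => R.ι i

/-- The differentials of the free resolution of `S ⧸ I` extending a free resolution of `I`. -/
def MinFreeRes.extD (R : MinFreeRes I) : ∀ i, (R.extIdx (i + 1) →₀ MvPolynomial V k)
    →ₗ[MvPolynomial V k] (R.extIdx i →₀ MvPolynomial V k)
  | 0 => Finsupp.lsingle () ∘ₗ R.aug
  | i + 1 => R.d i

lemma MinFreeRes.range_extD_succ (R : MinFreeRes I) :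
    ∀ i, LinearMap.range (R.extD (i + 1)) = LinearMap.ker (R.extD i)
  | 0 => by
    change LinearMap.range (R.d 0) = LinearMap.ker (Finsupp.lsingle () ∘ₗ R.aug)
    rw [R.exact_zero, LinearMap.ker_comp_of_ker_eq_bot]
    exact LinearMap.ker_eq_bot.mpr (Finsupp.single_injective ())
  | i + 1 => R.exact_succ i

lemma MinFreeRes.single_mem_range_extD_zero (R : MinFreeRes I) (p : MvPolynomial V k) :
    (Finsupp.single () p : R.extIdx 0 →₀ MvPolynomial V k) ∈ LinearMap.range (R.extD 0) ↔
      p ∈ I := by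
  refine Iff.trans ⟨?_, ?_⟩ (iff_of_eq (congrArg (p ∈ ·) R.aug_range))
  · rintro ⟨u, hu⟩
    exact ⟨u, Finsupp.single_injective () hu⟩
  · rintro ⟨u, rfl⟩
    exact ⟨u, rfl⟩

lemma map_mem_idealFree_of_single {S α β : Type} [CommRing S] {J : Ideal S}
    (f : (α →₀ S) →ₗ[S] (β →₀ S)) (hf : ∀ a b, f (Finsupp.single a 1) b ∈ J) (y : α →₀ S) :
    f y ∈ idealFree J β := by
  rw [← Finsupp.sum_single y, Finsupp.sum, map_sum]
  refine Submodule.sum_mem _ fun a _ => ?_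
  rw [← mul_one (y a), ← smul_eq_mul, ← Finsupp.smul_single, map_smul]
  exact Submodule.smul_mem _ _ ((mem_idealFree_iff J _).mpr (hf a))

lemma MinFreeRes.extD_mem (R : MinFreeRes I) (hI : I ≤ mIdeal k V) :
    ∀ i y, R.extD i y ∈ idealFree (mIdeal k V) (R.extIdx i)
  | 0, y => by
    refine (mem_idealFree_iff _ _).mpr fun b => ?_
    have : R.extD 0 y b = R.aug y := Finsupp.single_eq_same
    rw [this]
    exact hI (R.aug_range.le (LinearMap.mem_range_self _ y))
  | i + 1, y => map_mem_idealFree_of_single _ (R.minimal i) y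

lemma MinFreeRes.mem_pdSet_iff (R : MinFreeRes I) (i : ℕ) : i ∈ R.pdSet ↔ Nonempty (R.ι i) := by
  have := R.finite i
  constructor
  · rintro ⟨j, hj⟩
    obtain ⟨⟨⟨a, -⟩⟩, -⟩ := Nat.card_ne_zero.mp hj
    exact ⟨a⟩
  · rintro ⟨a⟩
    exact ⟨R.deg i a, Nat.card_ne_zero.mpr ⟨⟨⟨a, rfl⟩⟩, inferInstance⟩⟩

/-- Hilbert's syzygy theorem for minimal graded free resolutions of ideals. -/
lemma MinFreeRes.lt_card_of_mem_pdSet [Fintype V] (R : MinFreeRes I) (hI : I ≤ mIdeal k V)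
    {i : ℕ} (hi : i ∈ R.pdSet) : i < Fintype.card V := by
  by_contra! hc
  obtain ⟨a⟩ := (R.mem_pdSet_iff i).mp hi
  obtain ⟨u, hu⟩ := acyclic_mod_varIdeal R.extD R.range_extD_succ Finset.univ i
    (Finsupp.single (a : R.extIdx (i + 1)) 1) (by simpa using hc)
    (by rw [varIdeal_univ]; exact R.extD_mem hI _ _)
  rw [varIdeal_univ] at hu
  have := add_mem hu (R.extD_mem hI _ u)
  rw [sub_add_cancel, mem_idealFree_iff] at this
  exact one_notMem_mIdeal (Finsupp.single_eq_same (a := a) (b := (1 : MvPolynomial V k)) ▸ this a)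

/-- If `S ⧸ I` has a nonzero socle element then the minimal free resolution of `I` has the
maximal possible length. -/
lemma MinFreeRes.mem_pdSet_of_socle [Fintype V] (R : MinFreeRes I) {m : ℕ}
    (hm : Fintype.card V = m + 1) {f : MvPolynomial V k} (hf : f ∉ I)
    (hXf : ∀ l, X l * f ∈ I) : m ∈ R.pdSet := by
  rw [R.mem_pdSet_iff]
  by_contra hne
  rw [not_nonempty_iff] at hne
  have : IsEmpty (R.extIdx (m + 1)) := hne
  obtain ⟨y, hy, -⟩ := exists_socle_mod_varIdeal R.extD R.range_extD_succ
    (f := Finsupp.single () f) (mt (R.single_mem_range_extD_zero f).mp hf)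
    (fun l => by
      rw [Finsupp.smul_single, R.single_mem_range_extD_zero]
      exact hXf l)
    Finset.univ (m + 1) hm
  refine hy 0 ?_
  rw [Subsingleton.elim (y - _) 0]
  exact Submodule.zero_mem _

end Resolution

lemma edgeIdeal_le_mIdeal {V : Type} (E : Set (V × V)) (w : V → ℕ) :
    edgeIdeal k E w ≤ mIdeal k V := by
  refine Ideal.span_le.mpr ?_
  rintro _ ⟨e, -, rfl⟩
  exact Ideal.mul_mem_right _ _ (Ideal.subset_span ⟨e.1, rfl⟩)

lemma X_mul_X_pow_eq_monomial {V : Type} (a b : V) (m : ℕ) :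
    (X a * X b ^ m : MvPolynomial V k) =
      monomial (Finsupp.single a 1 + Finsupp.single b m) 1 := by
  rw [X_pow_eq_monomial, X, monomial_mul, one_mul]

lemma monomial_mem_edgeIdeal_iff {V : Type} (E : Set (V × V)) (w : V → ℕ) (c : V →₀ ℕ) :
    (monomial c 1 : MvPolynomial V k) ∈ edgeIdeal k E w ↔
      ∃ e ∈ E, Finsupp.single e.1 1 + Finsupp.single e.2 (w e.2) ≤ c := by
  have : {p : MvPolynomial V k | ∃ e ∈ E, p = X e.1 * X e.2 ^ w e.2} =
      (fun s => monomial s (1 : k)) ''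
        ((fun e : V × V => Finsupp.single e.1 1 + Finsupp.single e.2 (w e.2)) '' E) := by
    ext p
    simp only [Set.mem_ofPred_eq, Set.image_image, Set.mem_image, X_mul_X_pow_eq_monomial, eq_comm]
  rw [edgeIdeal, this, mem_ideal_span_monomial_image]
  classical simp [support_monomial]

section Socle

variable {V : Type} [Fintype V] {E : Set (V × V)} {w : V → ℕ}

lemma monomial_weight_sub_one_notMem_edgeIdeal (hw : ∀ v, w v ≠ 0) :
    (monomial (Finsupp.equivFunOnFinite.symm fun v => w v - 1) 1 : MvPolynomial V k) ∉
      edgeIdeal k E w := by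
  rw [monomial_mem_edgeIdeal_iff]
  rintro ⟨e, -, he⟩
  have := he e.2
  simp only [Finsupp.add_apply, Finsupp.single_eq_same, Finsupp.equivFunOnFinite_symm_apply_apply]
    at this
  have := hw e.2
  omega

lemma X_mul_monomial_weight_sub_one_mem_edgeIdeal (hw : ∀ v, 2 ≤ w v) {u v : V}
    (huv : u ≠ v) (he : (u, v) ∈ E) :
    (X v * monomial (Finsupp.equivFunOnFinite.symm fun v => w v - 1) 1 : MvPolynomial V k) ∈
      edgeIdeal k E w := by
  classical
  rw [X, monomial_mul, one_mul, monomial_mem_edgeIdeal_iff]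
  refine ⟨(u, v), he, fun t => ?_⟩
  have := hw t
  simp only [Finsupp.add_apply, Finsupp.single_apply, Finsupp.equivFunOnFinite_symm_apply_apply]
  by_cases h1 : u = t <;> by_cases h2 : v = t
  · exact absurd (h1.trans h2.symm) huv
  all_goals simp [h1, h2]; try (subst h2; omega)
  omega

end Socle

end WOG

/-- **Corollary (oriented cycle, regularity).**
`D` is the vertex-weighted oriented cycle on `x_1, …, x_n` (`n ≥ 3`), with
edges `(x_1,x_2), …, (x_{n-1},x_n), (x_n,x_1)`, and every weight is `≥ 2`.
Then `pd I(D) = |E| - 1`. -/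
theorem oriented_cycle_pd (k : Type) [Field k] (n : ℕ) (hn : 3 ≤ n)
    (E : Set (Fin n × Fin n))
    (hE : E = {p : Fin n × Fin n | (p.2 : ℕ) = ((p.1 : ℕ) + 1) % n})
    (w : Fin n → ℕ) (hw2 : ∀ i : Fin n, 2 ≤ w i)
    (R : WOG.MinFreeRes (WOG.edgeIdeal k E w)) :
    IsGreatest R.pdSet (Nat.card ↥E - 1) := by
  have hcard : Nat.card ↥E = n := by
    have e : ↥E ≃ Fin n :=
      { toFun := fun p => p.1.1
        invFun := fun i => ⟨(i, ⟨((i : ℕ) + 1) % n, Nat.mod_lt _ (by omega)⟩), by simp [hE]⟩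
        left_inv := by
          rintro ⟨⟨i, j⟩, h⟩
          rw [hE] at h
          exact Subtype.ext (Prod.ext rfl (Fin.ext h.symm))
        right_inv := fun _ => rfl }
    rw [Nat.card_congr e, Nat.card_eq_fintype_card, Fintype.card_fin]
  rw [hcard]
  refine ⟨R.mem_pdSet_of_socle (by rw [Fintype.card_fin]; omega)
    (WOG.monomial_weight_sub_one_notMem_edgeIdeal fun v => by have := hw2 v; omega)
    fun v => ?_, fun i hi => ?_⟩
  · have hmod : (v : ℕ) = ((v + (n - 1)) % n + 1) % n := by
      rw [Nat.mod_add_mod, show (v : ℕ) + (n - 1) + 1 = v + n by omega, Nat.add_mod_right,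
        Nat.mod_eq_of_lt v.2]
    refine WOG.X_mul_monomial_weight_sub_one_mem_edgeIdeal hw2
      (u := ⟨(v + (n - 1)) % n, Nat.mod_lt _ (by omega)⟩) (fun h => ?_) (hE.ge hmod)
    have h' : ((v : ℕ) + (n - 1)) % n = v := congrArg Fin.val h
    rw [h'] at hmod
    have hv := v.2
    rcases Nat.lt_or_ge ((v : ℕ) + 1) n with hlt | hge
    · rw [Nat.mod_eq_of_lt hlt] at hmod
      omega
    · rw [show (v : ℕ) + 1 = n by omega, Nat.mod_self] at hmod
      omega
  · have := R.lt_card_of_mem_pdSet (WOG.edgeIdeal_le_mIdeal E w) hi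
    rw [Fintype.card_fin] at this
    omega
end
end

section
/- Let D = (V,E,w) be a vertex-weighted oriented complete tripartite graph with parts V = V_1 ⊔ V_2 ⊔ V_3 (all nonempty), whose edges are exactly all pairs between V_1 and V_2 directed from V_1 to V_2, all pairs between V_2 and V_3 directed from V_2 to V_3, and all pairs between V_3 and V_1 directed from V_3 to V_1. If w(x) ≥ 2 for every vertex x, then reg(I(D)) = (Σ_{x ∈ V} w(x)) − |V| + 1. -/
open MvPolynomial

noncomputable section

namespace WOG

section Koszul

variable {V : Type} [LinearOrder V]

/-- The sign of adjoining `v` to `σ` in the Koszul complex. -/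
def sgn (v : V) (σ : Finset V) : ℤ := (-1) ^ (σ.filter (· < v)).card

lemma sgn_mul_self (v : V) (σ : Finset V) : sgn v σ * sgn v σ = 1 := by
  rw [sgn, ← mul_pow]; simp

lemma sgn_insert {u v : V} {σ : Finset V} (hv : v ∉ σ) :
    sgn u (insert v σ) = (if v < u then -1 else 1) * sgn u σ := by
  unfold sgn
  rw [Finset.filter_insert]
  split_ifs with h
  · rw [Finset.card_insert_of_notMem (by simp [hv]), pow_succ]; ring
  · simp

lemma sgn_swap {u v : V} {σ : Finset V} (huv : u ≠ v) (hu : u ∉ σ) (hv : v ∉ σ) :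
    sgn v σ * sgn u (insert v σ) = -(sgn u σ * sgn v (insert u σ)) := by
  rw [sgn_insert hv, sgn_insert hu]
  rcases lt_or_gt_of_ne huv with h | h
  · simp [h, h.not_gt]; ring
  · simp [h, h.not_gt]; ring

lemma sgn_insert_mul_sgn_insert {u v : V} {σ : Finset V} (huv : u ≠ v) (hu : u ∉ σ)
    (hv : v ∉ σ) : sgn u (insert v σ) * sgn v (insert u σ) = -(sgn v σ * sgn u σ) := by
  rw [sgn_insert hv, sgn_insert hu]
  rcases lt_or_gt_of_ne huv with h | h
  · simp [h, h.not_gt]; ring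
  · simp [h, h.not_gt]; ring

variable {A M N : Type} [CommRing A] [AddCommGroup M] [Module A M] [AddCommGroup N] [Module A N]

/-- The homotopy on the Koszul complex of the constant sequence `1` given by the
exterior product with `e_v`. -/
def wedge (v : V) (c : Finset V → M) (σ : Finset V) : M :=
  if v ∈ σ then sgn v (σ.erase v) • c (σ.erase v) else 0

lemma wedge_ne_zero {v : V} {c : Finset V → M} {σ : Finset V} (h : wedge v c σ ≠ 0) :
    v ∈ σ ∧ c (σ.erase v) ≠ 0 := by
  unfold wedge at h
  split_ifs at h with hv
  · exact ⟨hv, fun h0 => h (by simp [h0])⟩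
  · exact absurd rfl h

variable [Fintype V]

/-- The differential of the Koszul complex of the sequence `x` with coefficients in `M`. All
homological degrees are put together: the value at `σ` is the coefficient of the basis vector
`e_σ` of the exterior algebra. -/
def koszul (x : V → A) :
    (Finset V → M) →ₗ[A] (Finset V → M) where
  toFun f σ := ∑ v ∈ σᶜ, sgn v σ • x v • f (insert v σ)
  map_add' f g := by
    ext σ
    simp [Finset.sum_add_distrib]
  map_smul' a f := by
    ext σ
    simp only [Pi.smul_apply, RingHom.id_apply, Finset.smul_sum]
    refine Finset.sum_congr rfl fun v _ => ?_
    rw [smul_comm a, smul_comm a]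

lemma koszul_apply (x : V → A) (f : Finset V → M) (σ : Finset V) :
    koszul x f σ = ∑ v ∈ σᶜ, sgn v σ • x v • f (insert v σ) := rfl

lemma koszul_koszul (x : V → A) (f : Finset V → M) : koszul x (koszul x f) = 0 := by
  ext σ
  simp only [koszul_apply, Finset.smul_sum, Pi.zero_apply]
  rw [Finset.sum_sigma']
  refine Finset.sum_involution (fun p _ => ⟨p.2, p.1⟩) ?_ ?_ ?_ ?_
  · rintro ⟨v, u⟩ h
    simp only [Finset.mem_sigma, Finset.mem_compl, Finset.mem_insert, not_or] at h
    obtain ⟨hv, huv, hu⟩ := h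
    simp only
    rw [Finset.insert_comm v u, smul_comm (x v) (sgn u _), smul_comm (x u) (sgn v _), smul_smul,
      smul_smul (sgn u σ), smul_comm (x v) (x u), sgn_swap huv hu hv, neg_smul, neg_add_cancel]
  · rintro ⟨v, u⟩ h _ h'
    simp only [Finset.mem_sigma, Finset.mem_compl, Finset.mem_insert, not_or] at h
    simp only [Sigma.mk.injEq, heq_eq_eq] at h'
    exact h.2.1 h'.1
  · rintro ⟨v, u⟩ h
    simp only [Finset.mem_sigma, Finset.mem_compl, Finset.mem_insert, not_or] at h ⊢
    exact ⟨h.2.2, Ne.symm h.2.1, h.1⟩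
  · rintro ⟨v, u⟩ h
    rfl

lemma koszul_comp_map (x : V → A) (φ : M →ₗ[A] N) (f : Finset V → M) :
    koszul x (fun σ => φ (f σ)) = fun σ => φ (koszul x f σ) := by
  ext σ
  simp only [koszul_apply, map_sum, map_zsmul, map_smul]

lemma exists_ne_zero_of_koszul_ne_zero {x : V → A} {f : Finset V → M} {σ : Finset V}
    (h : koszul x f σ ≠ 0) : ∃ v ∉ σ, f (insert v σ) ≠ 0 := by
  rw [koszul_apply] at h
  obtain ⟨v, hv, hne⟩ := Finset.exists_ne_zero_of_sum_ne_zero h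
  refine ⟨v, by simpa using hv, fun h0 => hne (by simp [h0])⟩

lemma koszul_wedge_add (v : V) (c : Finset V → M) :
    koszul (1 : V → A) (wedge v c) + wedge v (koszul (1 : V → A) c) = c := by
  ext σ
  simp only [Pi.add_apply, koszul_apply, Pi.one_apply, one_smul]
  by_cases hv : v ∈ σ
  · obtain ⟨τ, hτ, rfl⟩ : ∃ τ, v ∉ τ ∧ σ = insert v τ :=
      ⟨σ.erase v, Finset.notMem_erase v σ, (Finset.insert_erase hv).symm⟩
    have e : τᶜ = insert v (insert v τ)ᶜ := by
      ext t
      by_cases h : t = v <;> simp [h, hτ]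
    rw [wedge, if_pos hv, koszul_apply, Finset.erase_insert hτ, e, Finset.sum_insert (by simp)]
    simp only [Pi.one_apply, one_smul, smul_add, smul_smul, sgn_mul_self, Finset.smul_sum]
    rw [add_left_comm, ← Finset.sum_add_distrib, Finset.sum_eq_zero, add_zero]
    intro u hu
    simp only [Finset.mem_compl, Finset.mem_insert, not_or] at hu
    rw [wedge, if_pos (by simp), Finset.insert_comm u v,
      Finset.erase_insert (by simp [hτ, Ne.symm hu.1]), smul_smul,
      sgn_insert_mul_sgn_insert hu.1 hu.2 hτ, neg_smul, neg_add_cancel]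
  · rw [wedge, if_neg hv, add_zero, Finset.sum_eq_single v]
    · simp [wedge, hv, smul_smul, sgn_mul_self]
    · intro u hu huv
      simp [wedge, hv, huv.symm]
    · intro h; simp [hv] at h

end Koszul

section Scalar

variable {V k : Type} [LinearOrder V] [Field k]

lemma wedge_subset {N : Finset V} {v : V} (hv : v ∈ N) {c : Finset V → k}
    (hc : ∀ σ, c σ ≠ 0 → σ ⊆ N) (σ : Finset V) (h : wedge v c σ ≠ 0) : σ ⊆ N := by
  obtain ⟨h1, h2⟩ := wedge_ne_zero h
  rw [← Finset.insert_erase h1]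
  exact Finset.insert_subset hv (hc _ h2)

variable [Fintype V]

/-- If the relation `G` is stable under adjoining `v`, then every cycle relative to `G` is a
boundary relative to `G`. -/
lemma exists_koszul_of_cone {N : Finset V} {G : Finset V → Prop} {v : V} (hv : v ∈ N)
    (hG : ∀ σ, σ ⊆ N → v ∉ σ → G σ → G (insert v σ)) {c : Finset V → k}
    (hc : ∀ σ, c σ ≠ 0 → σ ⊆ N) (hd : ∀ σ, koszul (1 : V → k) c σ ≠ 0 → G σ) :
    ∃ g : Finset V → k, (∀ σ, g σ ≠ 0 → σ ⊆ N) ∧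
      ∀ σ, (c - koszul (1 : V → k) g) σ ≠ 0 → G σ := by
  refine ⟨wedge v c, wedge_subset hv hc, fun σ hσ => ?_⟩
  rw [sub_eq_of_eq_add' (koszul_wedge_add (A := k) v c).symm] at hσ
  obtain ⟨h1, h2⟩ := wedge_ne_zero hσ
  obtain ⟨t, -, ht'⟩ := exists_ne_zero_of_koszul_ne_zero h2
  rw [← Finset.insert_erase h1]
  exact hG _ ((Finset.subset_insert _ _).trans (hc _ ht')) (Finset.notMem_erase _ _) (hd _ h2)

/-- The case in which the subsets whose complements fail `G` form two disjoint simplices, with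
vertex sets `a` and `b`. -/
lemma exists_koszul_of_two_simplices {a b b' : Finset V} (hab : Disjoint a b)
    (hab' : Disjoint a b') (hbb' : Disjoint b b') {G : Finset V → Prop}
    (hG : ∀ σ, σ ⊆ a ∪ b ∪ b' →
      (G σ ↔ (∃ y ∈ b', y ∉ σ) ∨ (∃ x ∈ a, x ∉ σ) ∧ ∃ y ∈ b, y ∉ σ))
    {v u : V} (hv : v ∈ a) (hu : u ∈ b) {c : Finset V → k}
    (hc : ∀ σ, c σ ≠ 0 → σ ⊆ a ∪ b ∪ b' ∧ 2 ≤ ((a ∪ b ∪ b') \ σ).card)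
    (hd : ∀ σ, koszul (1 : V → k) c σ ≠ 0 → G σ) :
    ∃ g : Finset V → k, (∀ σ, g σ ≠ 0 → σ ⊆ a ∪ b ∪ b') ∧
      ∀ σ, (c - koszul (1 : V → k) g) σ ≠ 0 → G σ := by
  classical
  set N := a ∪ b ∪ b' with hN
  have hvN : v ∈ N := by simp [hN, hv]
  have huN : u ∈ N := by simp [hN, hu]
  set p := wedge v (koszul (1 : V → k) c) with hp
  have hdN : ∀ σ, koszul (1 : V → k) c σ ≠ 0 → σ ⊆ N := fun σ h => by
    obtain ⟨t, -, ht⟩ := exists_ne_zero_of_koszul_ne_zero h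
    exact (Finset.subset_insert _ _).trans (hc _ ht).1
  have hpN : ∀ σ, p σ ≠ 0 → σ ⊆ N := wedge_subset hvN hdN
  set e : Finset V → k := fun σ => if G σ then 0 else p σ with he
  have he0 : ∀ σ, e σ ≠ 0 → ¬ G σ ∧ p σ ≠ 0 := fun σ h => by
    by_cases hσ : G σ
    · simp [he, hσ] at h
    · exact ⟨hσ, by simpa [he, hσ] using h⟩
  have hi0 : ∀ σ, (p - e) σ ≠ 0 → G σ ∧ p σ ≠ 0 := fun σ h => by
    by_cases hσ : G σ
    · exact ⟨hσ, by simpa [he, hσ] using h⟩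
    · simp [he, hσ] at h
  have hanti : ∀ σ t, insert t σ ⊆ N → G (insert t σ) → G σ := fun σ t hs h => by
    rw [hG _ hs] at h
    rw [hG _ ((Finset.subset_insert _ _).trans hs)]
    simp only [Finset.mem_insert, not_or] at h
    rcases h with ⟨y, hy, -, h⟩ | ⟨⟨x, hx, -, h⟩, y, hy, -, h'⟩
    · exact Or.inl ⟨y, hy, h⟩
    · exact Or.inr ⟨⟨x, hx, h⟩, y, hy, h'⟩
  have hcp : c = koszul (1 : V → k) (wedge v c) + p := (koszul_wedge_add v c).symm
  have hdp : koszul (1 : V → k) p = koszul (1 : V → k) c := by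
    conv_rhs => rw [hcp, map_add, koszul_koszul, zero_add]
  have hde : ∀ σ, koszul (1 : V → k) e σ ≠ 0 → G σ := fun σ h => by
    by_contra hσ
    have h1 : koszul (1 : V → k) c σ = 0 := by_contra fun h => hσ (hd _ h)
    have h2 : koszul (1 : V → k) (p - e) σ = 0 := by
      by_contra h
      obtain ⟨t, -, ht⟩ := exists_ne_zero_of_koszul_ne_zero h
      obtain ⟨h3, h4⟩ := hi0 _ ht
      exact hσ (hanti σ t (hpN _ h4) h3)
    rw [map_sub, Pi.sub_apply, hdp, h1, zero_sub, neg_eq_zero] at h2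
    exact h h2
  refine ⟨wedge v c + wedge u e, fun σ h => ?_, fun σ h => ?_⟩
  · by_cases h1 : wedge v c σ = 0
    · rw [Pi.add_apply, h1, zero_add] at h
      exact wedge_subset huN (fun σ h => hpN _ (he0 _ h).2) σ h
    · exact wedge_subset hvN (fun σ h => (hc _ h).1) σ h1
  have h3 : c - koszul (1 : V → k) (wedge v c + wedge u e)
      = (p - e) + wedge u (koszul (1 : V → k) e) := by
    have := koszul_wedge_add (A := k) u e
    rw [map_add, ← sub_sub, sub_eq_of_eq_add' hcp, eq_sub_of_add_eq' this]
    abel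
  rw [h3] at h
  by_cases h4 : (p - e) σ = 0
  swap
  · exact (hi0 _ h4).1
  rw [Pi.add_apply, h4, zero_add] at h
  obtain ⟨huσ, h5⟩ := wedge_ne_zero h
  have hGu := hde _ h5
  obtain ⟨t, -, ht⟩ := exists_ne_zero_of_koszul_ne_zero h5
  obtain ⟨hG1, h6⟩ := he0 _ ht
  have hs1 := hpN _ h6
  set σ₁ := insert t (σ.erase u) with hσ₁
  obtain ⟨hv1, h7⟩ := wedge_ne_zero h6
  have hGv := hd _ h7
  obtain ⟨s, hs, h8⟩ := exists_ne_zero_of_koszul_ne_zero h7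
  have hcard : 2 ≤ (N \ σ₁).card := by
    have h9 := (hc _ h8).2
    rw [Finset.card_sdiff_of_subset (hc _ h8).1, Finset.card_insert_of_notMem hs,
      Finset.card_erase_add_one hv1] at h9
    rwa [Finset.card_sdiff_of_subset hs1]
  have hσN : σ ⊆ N := by
    rw [← Finset.insert_erase huσ]
    exact Finset.insert_subset huN ((Finset.subset_insert _ _).trans hs1)
  by_contra hGσ
  rw [hG _ ((Finset.erase_subset _ _).trans hσN)] at hGu
  rw [hG _ ((Finset.erase_subset _ _).trans hs1)] at hGv
  rw [hG _ hs1] at hG1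
  rw [hG _ hσN] at hGσ
  rw [Finset.disjoint_left] at hab hab' hbb'
  have hA : ∀ x ∈ a, x ∈ σ₁ := by
    by_contra! hA
    refine hG1 ?_
    rcases hGv with ⟨y, hy, h9⟩ | ⟨-, y, hy, h9⟩
    · exact Or.inl ⟨y, hy, fun h => h9 (Finset.mem_erase.2 ⟨fun h => hab' hv (h ▸ hy), h⟩)⟩
    · exact Or.inr
        ⟨hA, y, hy, fun h => h9 (Finset.mem_erase.2 ⟨fun h => hab hv (h ▸ hy), h⟩)⟩
  have hB' : ∀ y ∈ b', y ∈ σ := by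
    by_contra! h
    exact hGσ (Or.inl h)
  obtain ⟨x, hx, hxσ⟩ : ∃ x ∈ a, x ∉ σ := by
    by_contra! hx
    rcases hGu with ⟨y, hy, h9⟩ | ⟨⟨x, hxa, h9⟩, -⟩
    · exact h9 (Finset.mem_erase.2 ⟨fun h => hbb' hu (h ▸ hy), hB' y hy⟩)
    · exact h9 (Finset.mem_erase.2 ⟨fun h => hab hxa (h ▸ hu), hx x hxa⟩)
  have hxt : x = t := by
    rcases Finset.mem_insert.1 (hA x hx) with h | h
    · exact h
    · exact absurd (Finset.mem_of_mem_erase h) hxσ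
  have hB : ∀ y ∈ b, y ∈ σ := by
    by_contra! h
    exact hGσ (Or.inr ⟨⟨x, hx, hxσ⟩, h⟩)
  obtain ⟨z, hz, hzu⟩ := Finset.exists_mem_ne (by omega : 1 < (N \ σ₁).card) u
  rw [Finset.mem_sdiff, hN, Finset.mem_union, Finset.mem_union] at hz
  have hz1 : z ∉ σ := fun h => hz.2 (Finset.mem_insert_of_mem (Finset.mem_erase.2 ⟨hzu, h⟩))
  rcases hz.1 with (h | h) | h
  · exact hz.2 (hA z h)
  · exact hz1 (hB z h)
  · exact hz1 (hB' z h)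

end Scalar

section Multidegree

variable {V k : Type} [Field k]

/-- The exponent of the squarefree monomial `∏ v ∈ σ, X v`. -/
def ind (σ : Finset V) : V →₀ ℕ := Finsupp.indicator σ fun _ _ => 1

/-- The coefficients of the component of multidegree `α`. -/
def comp (α : V →₀ ℕ) (f : Finset V → MvPolynomial V k) (σ : Finset V) : k :=
  if ind σ ≤ α then coeff (α - ind σ) (f σ) else 0

lemma comp_add_ind (β : V →₀ ℕ) (f : Finset V → MvPolynomial V k) (σ : Finset V) :
    comp (β + ind σ) f σ = coeff β (f σ) := by
  simp [comp]

lemma coeff_zsmul' (β : V →₀ ℕ) (n : ℤ) (p : MvPolynomial V k) :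
    coeff β (n • p) = n • coeff β p := map_zsmul (lcoeff k β) n p

variable [LinearOrder V]

lemma ind_apply (σ : Finset V) (v : V) : ind σ v = if v ∈ σ then 1 else 0 := by
  simp [ind, Finsupp.indicator_apply]

lemma ind_insert {v : V} {σ : Finset V} (hv : v ∉ σ) :
    ind (insert v σ) = ind σ + Finsupp.single v 1 := by
  ext u
  by_cases h : u = v
  · subst h; simp [ind_apply, hv]
  · simp [ind_apply, h]

lemma ind_le {σ : Finset V} {α : V →₀ ℕ} : ind σ ≤ α ↔ σ ⊆ α.support := by
  refine ⟨fun h v hv => ?_, fun h v => ?_⟩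
  · have := h v
    simp only [ind_apply, hv, if_true] at this
    simp; omega
  · rw [ind_apply]
    split_ifs with hv
    · have := h hv
      simp at this; omega
    · exact Nat.zero_le _

/-- The element of multidegree `α` in the Koszul complex with coefficients `c`. -/
def mon (α : V →₀ ℕ) (c : Finset V → k) (σ : Finset V) : MvPolynomial V k :=
  if ind σ ≤ α then monomial (α - ind σ) (c σ) else 0

lemma coeff_mon (α β : V →₀ ℕ) (c : Finset V → k) (σ : Finset V) :
    coeff β (mon α c σ) = if α = β + ind σ then c σ else 0 := by
  unfold mon
  by_cases h : α = β + ind σ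
  · subst h
    simp
  · rw [if_neg h]
    split_ifs with h1
    · rw [coeff_monomial, if_neg]
      rintro rfl
      exact h (tsub_add_cancel_of_le h1).symm
    · simp

lemma mon_sub (α : V →₀ ℕ) (c c' : Finset V → k) : mon α (c - c') = mon α c - mon α c' := by
  ext σ β
  simp only [Pi.sub_apply, coeff_sub, coeff_mon]
  split_ifs <;> simp

variable [Fintype V]

lemma koszul_mon {α : V →₀ ℕ} {c : Finset V → k} (hc : ∀ σ, c σ ≠ 0 → σ ⊆ α.support) :
    koszul (X : V → MvPolynomial V k) (mon α c) = mon α (koszul (1 : V → k) c) := by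
  ext σ β
  have key : ∀ v ∈ σᶜ, coeff β (sgn v σ • (X v : MvPolynomial V k) • mon α c (insert v σ)) =
      if α = β + ind σ then sgn v σ • (1 : V → k) v • c (insert v σ) else 0 := fun v hv => by
    have hv' : v ∉ σ := by simpa using hv
    rw [coeff_zsmul', smul_eq_mul, coeff_X_mul', coeff_mon, ind_insert hv', Pi.one_apply,
      one_smul]
    by_cases hβ : v ∈ β.support
    · have : β - Finsupp.single v 1 + (ind σ + Finsupp.single v 1) = β + ind σ := by
        rw [add_comm (ind σ), ← add_assoc, tsub_add_cancel_of_le]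
        simpa [Nat.one_le_iff_ne_zero] using hβ
      rw [if_pos hβ, this, smul_ite, smul_zero]
    · rw [if_neg hβ, smul_zero]
      split_ifs with h
      · have : c (insert v σ) = 0 := by
          by_contra h0
          have := hc _ h0 (Finset.mem_insert_self v σ)
          simp_all [ind_apply]
        rw [this, smul_zero]
      · rfl
  rw [coeff_mon, koszul_apply, coeff_sum, koszul_apply, Finset.sum_congr rfl key]
  split_ifs <;> simp

lemma comp_koszul (α : V →₀ ℕ) (f : Finset V → MvPolynomial V k) :
    comp α (koszul (X : V → MvPolynomial V k) f) = koszul (1 : V → k) (comp α f) := by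
  ext σ
  by_cases h : ind σ ≤ α
  · rw [comp, if_pos h, koszul_apply, koszul_apply, coeff_sum]
    refine Finset.sum_congr rfl fun v hv => ?_
    have hv' : v ∉ σ := by simpa using hv
    rw [coeff_zsmul', smul_eq_mul, coeff_X_mul', Pi.one_apply, one_smul, comp, ind_insert hv',
      tsub_add_eq_tsub_tsub]
    congr 1
    refine if_congr ?_ rfl rfl
    rw [← ind_insert hv', ind_le, Finset.insert_subset_iff, ← ind_le (σ := σ)]
    simp [h, ind_apply, hv']
  · rw [comp, if_neg h, koszul_apply, Finset.sum_eq_zero]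
    intro v hv
    have hv' : v ∉ σ := by simpa using hv
    rw [comp, if_neg, smul_zero, smul_zero]
    rw [ind_insert hv']
    exact fun h' => h (le_self_add.trans h')

/-- To solve an equation modulo a monomial submodule in the Koszul complex of the variables it
suffices to do so in each multidegree. -/
lemma exists_koszul_of_comp {f : Finset V → MvPolynomial V k} {P : (V →₀ ℕ) → Prop}
    {Q : (V →₀ ℕ) → Finset V → Prop}
    (h : ∀ α, ∃ g : Finset V → k, (∀ σ, g σ ≠ 0 → σ ⊆ α.support ∧ Q α σ) ∧
      ∀ σ, σ ⊆ α.support → (comp α f - koszul (1 : V → k) g) σ ≠ 0 → P (α - ind σ)) :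
    ∃ g : Finset V → MvPolynomial V k, (∀ σ β, coeff β (g σ) ≠ 0 → Q (β + ind σ) σ) ∧
      ∀ σ β, coeff β ((f - koszul (X : V → MvPolynomial V k) g) σ) ≠ 0 → P β := by
  classical
  choose g hg hP using h
  let T : Finset (V →₀ ℕ) :=
    Finset.univ.biUnion fun σ => (f σ).support.image (· + ind σ)
  have hT : ∀ (c : (V →₀ ℕ) → Finset V → k) (σ) (β),
      coeff β ((∑ α ∈ T, mon α (c α)) σ) = if β + ind σ ∈ T then c (β + ind σ) σ else 0 := by
    intro c σ β
    rw [Finset.sum_apply, coeff_sum]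
    simp only [coeff_mon]
    rw [Finset.sum_ite_eq' T (β + ind σ) (fun α => c α σ)]
  have hf : f = ∑ α ∈ T, mon α (comp α f) := by
    ext σ β
    rw [hT, comp_add_ind]
    split_ifs with h
    · rfl
    · by_contra h0
      exact h (Finset.mem_biUnion.2 ⟨σ, Finset.mem_univ _,
        Finset.mem_image.2 ⟨β, mem_support_iff.2 h0, rfl⟩⟩)
  refine ⟨∑ α ∈ T, mon α (g α), fun σ β h => ?_, fun σ β h => ?_⟩
  · rw [hT] at h
    split_ifs at h with h1
    · exact (hg _ _ h).2
    · exact absurd rfl h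
  · have e : f - koszul (X : V → MvPolynomial V k) (∑ α ∈ T, mon α (g α)) =
        ∑ α ∈ T, mon α (comp α f - koszul (1 : V → k) (g α)) := by
      conv_lhs => rw [hf]
      rw [map_sum, ← Finset.sum_sub_distrib]
      refine Finset.sum_congr rfl fun α _ => ?_
      rw [koszul_mon fun σ h => (hg α σ h).1, mon_sub]
    rw [e, hT] at h
    split_ifs at h with h1
    · have := hP _ _ (ind_le.1 le_add_self) h
      rwa [add_tsub_cancel_right] at this
    · exact absurd rfl h

/-- Exactness of the Koszul complex of the variables. -/
lemma exists_koszul_eq {f : Finset V → MvPolynomial V k}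
    (hf : koszul (X : V → MvPolynomial V k) f = 0) (hf0 : coeff 0 (f ∅) = 0) :
    ∃ g : Finset V → MvPolynomial V k, koszul (X : V → MvPolynomial V k) g = f ∧
      ∀ σ β, coeff β (g σ) ≠ 0 →
        ∃ v ∈ σ, coeff (β + Finsupp.single v 1) (f (σ.erase v)) ≠ 0 := by
  obtain ⟨g, hg, hfg⟩ := exists_koszul_of_comp (f := f) (P := fun _ => False)
    (Q := fun α σ => ∃ v ∈ σ, comp α f (σ.erase v) ≠ 0) fun α => by
      have hc : ∀ σ, comp α f σ ≠ 0 → σ ⊆ α.support := fun σ h => by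
        by_contra h'
        rw [← ind_le] at h'
        simp [comp, h'] at h
      by_cases hα : α = 0
      · refine ⟨0, by simp, fun σ hσ h => ?_⟩
        subst hα
        have : σ = ∅ := by simpa using hσ
        subst this
        simp [comp, hf0] at h
      · obtain ⟨v, hv⟩ := Finsupp.support_nonempty_iff.2 hα
        refine ⟨wedge v (comp α f), fun σ h => ⟨wedge_subset hv hc σ h, v, wedge_ne_zero h⟩, ?_⟩
        intro σ _ h
        rw [sub_eq_of_eq_add' (koszul_wedge_add (A := k) v _).symm, ← comp_koszul, hf] at h
        obtain ⟨-, h⟩ := wedge_ne_zero h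
        simp [comp] at h
  refine ⟨g, ?_, fun σ β h => ?_⟩
  · ext σ β
    by_contra h
    exact hfg σ β (by rw [Pi.sub_apply, coeff_sub]; exact sub_ne_zero.2 (Ne.symm h))
  · obtain ⟨v, hv, h1⟩ := hg σ β h
    refine ⟨v, hv, ?_⟩
    have : ind σ = ind (σ.erase v) + Finsupp.single v 1 := by
      rw [← ind_insert (Finset.notMem_erase v σ), Finset.insert_erase hv]
    rwa [this, ← add_assoc, add_right_comm, comp_add_ind] at h1

end Multidegree

section Tripartite

variable {V k : Type}

/-- The exponents of the monomials in the edge ideal of a cyclically oriented complete tripartite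
graph. -/
def IsEdgeExponent (part : V → Fin 3) (w : V → ℕ) (β : V →₀ ℕ) : Prop :=
  ∃ x y, part y = part x + 1 ∧ 1 ≤ β x ∧ w y ≤ β y

lemma fin_three_cases (i j : Fin 3) : j = i ∨ j = i + 1 ∨ j = i + 2 := by
  revert i j; decide

variable [LinearOrder V]

lemma sub_ind_apply (α : V →₀ ℕ) (σ : Finset V) (z : V) :
    (α - ind σ) z = α z - if z ∈ σ then 1 else 0 := by
  rw [Finsupp.tsub_apply, ind_apply]

variable [Fintype V] [Field k] {part : V → Fin 3} {w : V → ℕ}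

lemma exists_scalar_koszul (hw : ∀ x, 2 ≤ w x) {α : V →₀ ℕ} {c : Finset V → k}
    (hc : ∀ σ, c σ ≠ 0 → σ ⊆ α.support ∧ ∑ x, (w x - 1) < (α - ind σ).degree)
    (hd : ∀ σ, koszul (1 : V → k) c σ ≠ 0 → IsEdgeExponent part w (α - ind σ)) :
    ∃ g : Finset V → k, (∀ σ, g σ ≠ 0 → σ ⊆ α.support) ∧
      ∀ σ, (c - koszul (1 : V → k) g) σ ≠ 0 → IsEdgeExponent part w (α - ind σ) := by
  by_cases hcone : ∃ v ∈ α.support, ∀ σ, σ ⊆ α.support → v ∉ σ →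
      IsEdgeExponent part w (α - ind σ) → IsEdgeExponent part w (α - ind (insert v σ))
  · obtain ⟨v, hv, h⟩ := hcone
    exact exists_koszul_of_cone (G := fun σ => IsEdgeExponent part w (α - ind σ)) hv h
      (fun σ h => (hc σ h).1) hd
  push Not at hcone
  have hval : ∀ v, α v ≠ 0 → α v = 1 ∨ α v = w v := by
    intro v hv
    obtain ⟨σ, -, hvσ, ⟨x, y, hxy, hx, hy⟩, hJ⟩ := hcone v (by simpa using hv)
    by_contra! h
    refine hJ ⟨x, y, hxy, ?_, ?_⟩
    · rw [sub_ind_apply] at *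
      by_cases hxv : x = v
      · subst hxv; simp; omega
      · simpa [hxv] using hx
    · rw [sub_ind_apply] at *
      by_cases hyv : y = v
      · subst hyv; simp [hvσ] at *; omega
      · simpa [hyv] using hy
  have hstar : ∀ v, α v ≠ 0 →
      (α v = 1 ∧ (∀ z, part z = part v → α z ≠ w z) ∧ ∃ y, part y = part v + 1 ∧ α y = w y) ∨
      (α v = w v ∧ ∃ x, part v = part x + 1 ∧ α x ≠ 0) := by
    intro v hv
    obtain ⟨σ, -, hvσ, ⟨x, y, hxy, hx, hy⟩, hJ⟩ := hcone v (by simpa using hv)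
    rw [sub_ind_apply] at hx hy
    have hy0 : α y = w y := by
      have := hw y
      rcases hval y (by omega) with h | h <;> omega
    by_cases hyv : y = v
    · subst hyv
      exact Or.inr ⟨hy0, x, hxy, by omega⟩
    have hy1 : w y ≤ (α - ind (insert v σ)) y := by
      rw [sub_ind_apply]; simpa [hyv] using hy
    have key : ∀ z, part y = part z + 1 → ¬ 1 ≤ (α - ind (insert v σ)) z :=
      fun z hz h => hJ ⟨z, y, hz, h, hy1⟩
    simp only [sub_ind_apply] at key
    have hxv : x = v := by
      by_contra hxv
      exact key x hxy (by simpa [hxv] using hx)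
    subst hxv
    have h1 : α x = 1 := by
      have := key x hxy
      simp at this; omega
    refine Or.inl ⟨h1, fun z hz h => key z (by rw [hz, hxy]) ?_, y, hxy, hy0⟩
    have := hw z
    split_ifs <;> omega
  by_cases hA : ∀ v, α v ≠ 0 → α v = w v
  · refine ⟨0, by simp, fun σ h => ?_⟩
    rw [map_zero, sub_zero] at h
    obtain ⟨-, h⟩ := hc σ h
    rw [Finsupp.degree_eq_sum] at h
    obtain ⟨y, -, hy⟩ := Finset.exists_lt_of_sum_lt h
    have hy' := hy
    rw [sub_ind_apply] at hy'
    rcases hstar y (by omega) with ⟨h1, h2, -⟩ | ⟨-, x, hx, h2⟩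
    · exact absurd (hA y (by omega)) (h2 y rfl)
    · refine ⟨x, y, hx, ?_, by omega⟩
      rw [sub_ind_apply, hA x h2]
      have := hw x
      split_ifs <;> omega
  push Not at hA
  obtain ⟨v, hv, hvw⟩ := hA
  obtain ⟨hv1, hBv, u, hu, huw⟩ := (hstar v hv).resolve_right fun h => hvw h.1
  have hA1 : ∀ x, α x = 1 → part x = part v := fun x hx => by
    have h2 := hw x
    obtain ⟨-, h3, y, h4, h5⟩ := (hstar x (by omega)).resolve_right fun h => by omega
    rcases fin_three_cases (part v) (part x) with h | h | h
    · exact h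
    · exact absurd huw (h3 u (hu.trans h.symm))
    · refine absurd h5 (hBv y ?_)
      rw [h4, h, add_assoc]
      exact add_zero _
  have hB2 : ∀ y, α y = w y → part y ≠ part v + 1 → part y = part u + 1 := fun y hy h => by
    rcases fin_three_cases (part v) (part y) with h' | h' | h'
    · exact absurd hy (hBv y h')
    · exact absurd h' h
    · rw [h', hu, add_assoc]; rfl
  set a := α.support.filter fun x => α x = 1 with ha
  set b := α.support.filter fun x => α x = w x ∧ part x = part v + 1 with hb
  set b' := α.support.filter fun x => α x = w x ∧ part x ≠ part v + 1 with hb'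
  have hN : α.support = a ∪ b ∪ b' := by
    ext x
    simp only [ha, hb, hb', Finset.mem_union, Finset.mem_filter, Finsupp.mem_support_iff]
    have := hval x
    tauto
  have hcard : ∀ σ, c σ ≠ 0 → 2 ≤ (α.support \ σ).card := fun σ hσ => by
    have h := (hc σ hσ).2
    by_contra! h2
    have h3 : ∑ z, (α - ind σ) z < ∑ z, ((w z - 1) + if z ∈ α.support \ σ then 1 else 0) := by
      refine Finset.sum_lt_sum (fun z _ => ?_) ⟨v, Finset.mem_univ v, ?_⟩
      · have h4 := hw z
        have h5 := hval z
        rw [sub_ind_apply]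
        by_cases hz : z ∈ σ <;> by_cases hz' : α z = 0 <;> simp [hz, hz'] <;> omega
      · have h4 := hw v
        rw [sub_ind_apply]
        by_cases hz : v ∈ σ <;> simp [hz, hv1] <;> omega
    rw [Finset.sum_add_distrib, Finset.sum_boole, ← Finsupp.degree_eq_sum,
      Finset.filter_mem_eq_inter, Finset.univ_inter] at h3
    simp only [Nat.cast_id] at h3
    omega
  rw [hN] at hc hcard
  have := exists_koszul_of_two_simplices (a := a) (b := b) (b' := b')
    (G := fun σ => IsEdgeExponent part w (α - ind σ)) (v := v) (u := u) ?_ ?_ ?_ ?_ ?_ ?_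
    (fun σ h => ⟨(hc σ h).1, hcard σ h⟩) hd
  · rwa [← hN] at this
  · rw [Finset.disjoint_left]
    intro x hx hx'
    have := hw x
    simp only [ha, hb, Finset.mem_filter] at hx hx'
    omega
  · rw [Finset.disjoint_left]
    intro x hx hx'
    have := hw x
    simp only [ha, hb', Finset.mem_filter] at hx hx'
    omega
  · rw [Finset.disjoint_left]
    intro x hx hx'
    simp only [hb, hb', Finset.mem_filter] at hx hx'
    exact hx'.2.2 hx.2.2
  · intro σ _
    constructor
    · rintro ⟨x, y, hxy, hx, hy⟩
      rw [sub_ind_apply] at hx hy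
      have hwy := hw y
      have hyσ : y ∉ σ := fun h => by
        rw [if_pos h] at hy
        rcases hval y (by omega) with h | h <;> omega
      rw [if_neg hyσ] at hy
      have hyw : α y = w y := by rcases hval y (by omega) with h | h <;> omega
      by_cases hyp : part y = part v + 1
      · have hxp : part x = part v := add_right_cancel (hxy.symm.trans hyp)
        have hx1 : α x = 1 := (hval x (by omega)).resolve_right (hBv x hxp)
        have hxσ : x ∉ σ := fun h => by
          rw [if_pos h] at hx
          omega
        refine Or.inr ⟨⟨x, ?_, hxσ⟩, y, ?_, hyσ⟩
        · simp [ha, hx1]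
        · simp only [hb, Finset.mem_filter, Finsupp.mem_support_iff]
          exact ⟨by omega, hyw, hyp⟩
      · refine Or.inl ⟨y, ?_, hyσ⟩
        simp only [hb', Finset.mem_filter, Finsupp.mem_support_iff]
        exact ⟨by omega, hyw, hyp⟩
    · rintro (⟨y, hy, hyσ⟩ | ⟨⟨x, hx, hxσ⟩, y, hy, hyσ⟩)
      · simp only [hb', Finset.mem_filter] at hy
        refine ⟨u, y, hB2 y hy.2.1 hy.2.2, ?_, ?_⟩
        · have := hw u
          rw [sub_ind_apply]
          split_ifs <;> omega
        · rw [sub_ind_apply, if_neg hyσ]; omega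
      · simp only [ha, hb, Finset.mem_filter] at hx hy
        refine ⟨x, y, by rw [hy.2.2, hA1 x hx.2], ?_, ?_⟩
        · rw [sub_ind_apply, if_neg hxσ]; omega
        · rw [sub_ind_apply, if_neg hyσ]; omega
  · simp [ha, hv1]
  · have := hw u
    simp only [hb, Finset.mem_filter, Finsupp.mem_support_iff]
    exact ⟨by omega, huw, hu⟩

/-- Vanishing of the Koszul homology of the quotient by the edge ideal, for cycles whose
coefficients have degree greater than `∑ x, (w x - 1)`. -/
lemma exists_koszul_of_lt_degree (hw : ∀ x, 2 ≤ w x) {f : Finset V → MvPolynomial V k}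
    (hf : ∀ σ β, coeff β (f σ) ≠ 0 → ∑ x, (w x - 1) < β.degree)
    (hd : ∀ σ β, coeff β (koszul (X : V → MvPolynomial V k) f σ) ≠ 0 →
      IsEdgeExponent part w β) :
    ∃ g : Finset V → MvPolynomial V k, ∀ σ β,
      coeff β ((f - koszul (X : V → MvPolynomial V k) g) σ) ≠ 0 → IsEdgeExponent part w β := by
  obtain ⟨g, -, hg⟩ := exists_koszul_of_comp (f := f) (P := IsEdgeExponent part w)
    (Q := fun _ _ => True) fun α => by
      have h1 : ∀ (f : Finset V → MvPolynomial V k) σ, comp α f σ ≠ 0 →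
          ind σ ≤ α ∧ coeff (α - ind σ) (f σ) ≠ 0 := fun f σ h => by
        unfold comp at h
        split_ifs at h with h1
        · exact ⟨h1, h⟩
        · exact absurd rfl h
      obtain ⟨g, hg, hg'⟩ := exists_scalar_koszul (part := part) hw (α := α) (c := comp α f)
        (fun σ h => ⟨ind_le.1 (h1 f σ h).1, hf _ _ (h1 f σ h).2⟩)
        (fun σ h => by rw [← comp_koszul] at h; exact hd _ _ (h1 _ σ h).2)
      exact ⟨g, fun σ h => ⟨hg σ h, trivial⟩, fun σ _ h => hg' σ h⟩
  exact ⟨g, hg⟩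

end Tripartite

section Resolution

/-- A graded complex of finite free modules over `k[V]` which is minimal, and exact except
possibly at its right end. -/
structure MinimalComplex (V k : Type) [Field k] where
  ι : ℕ → Type
  deg : ∀ i, ι i → ℕ
  d : ∀ i, (ι (i + 1) →₀ MvPolynomial V k) →ₗ[MvPolynomial V k] (ι i →₀ MvPolynomial V k)
  exact : ∀ i v, d i v = 0 → ∃ u, d (i + 1) u = v
  d_d : ∀ i u, d i (d (i + 1) u) = 0
  homog : ∀ i a b β, coeff β (d i (Finsupp.single a 1) b) ≠ 0 →
    deg (i + 1) a = deg i b + β.degree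
  minimal : ∀ i a b, coeff 0 (d i (Finsupp.single a 1) b) = 0

variable {V k : Type} [Field k]

lemma coeff_map_ne_zero {ι κ : Type}
    {φ : (ι →₀ MvPolynomial V k) →ₗ[MvPolynomial V k] (κ →₀ MvPolynomial V k)}
    {v : ι →₀ MvPolynomial V k} {b : κ} {β : V →₀ ℕ} (h : coeff β (φ v b) ≠ 0) :
    ∃ a β₁ β₂, β₁ + β₂ = β ∧ coeff β₁ (v a) ≠ 0 ∧
      coeff β₂ (φ (Finsupp.single a 1) b) ≠ 0 := by
  classical
  have e : φ v b = ∑ a ∈ v.support, v a * φ (Finsupp.single a 1) b := by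
    conv_lhs => rw [← Finsupp.sum_single v]
    rw [Finsupp.sum, map_sum, Finsupp.finsetSum_apply]
    refine Finset.sum_congr rfl fun a _ => ?_
    rw [← smul_eq_mul, ← Finsupp.smul_apply, ← map_smul, Finsupp.smul_single, smul_eq_mul,
      mul_one]
  rw [e, coeff_sum] at h
  obtain ⟨a, -, h⟩ := Finset.exists_ne_zero_of_sum_ne_zero h
  rw [coeff_mul] at h
  obtain ⟨⟨β₁, β₂⟩, h1, h⟩ := Finset.exists_ne_zero_of_sum_ne_zero h
  exact ⟨a, β₁, β₂, Finset.HasAntidiagonal.mem_antidiagonal.1 h1, left_ne_zero_of_mul h, right_ne_zero_of_mul h⟩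

lemma exists_koszul_eq_finsupp [Fintype V] [LinearOrder V] {ι : Type} {f : Finset V → ι →₀ MvPolynomial V k}
    (hf : koszul (X : V → MvPolynomial V k) f = 0) (hf0 : ∀ b, coeff 0 (f ∅ b) = 0) :
    ∃ g : Finset V → ι →₀ MvPolynomial V k, koszul (X : V → MvPolynomial V k) g = f ∧
      ∀ σ b β, coeff β (g σ b) ≠ 0 →
        ∃ v ∈ σ, coeff (β + Finsupp.single v 1) (f (σ.erase v) b) ≠ 0 := by
  classical
  have h : ∀ b, ∃ g : Finset V → MvPolynomial V k,
      (koszul (X : V → MvPolynomial V k) g = fun σ => f σ b) ∧ ∀ σ β, coeff β (g σ) ≠ 0 →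
        ∃ v ∈ σ, coeff (β + Finsupp.single v 1) (f (σ.erase v) b) ≠ 0 := fun b => by
    refine exists_koszul_eq ?_ (hf0 b)
    refine (koszul_comp_map X (Finsupp.lapply (R := MvPolynomial V k) b) f).trans ?_
    rw [hf]
    rfl
  choose g hg hgf using h
  have hg0 : ∀ σ b, b ∉ Finset.univ.biUnion (fun τ => (f τ).support) → g b σ = 0 := by
    intro σ b hb
    ext β
    by_contra h
    obtain ⟨v, -, h⟩ := hgf b σ β h
    exact hb (Finset.mem_biUnion.2 ⟨σ.erase v, Finset.mem_univ _,
      Finsupp.mem_support_iff.2 fun h0 => h (by simp [h0])⟩)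
  let g' : Finset V → ι →₀ MvPolynomial V k := fun σ =>
    Finsupp.onFinset (Finset.univ.biUnion fun τ => (f τ).support) (fun b => g b σ)
      fun b h => by_contra fun h' => h (hg0 σ b h')
  refine ⟨g', ?_, fun σ b β h => hgf b σ β h⟩
  ext1 σ
  ext1 b
  exact (congrFun (koszul_comp_map X (Finsupp.lapply (R := MvPolynomial V k) b) g') σ).symm.trans
    (congrFun (hg b) σ)

namespace MinimalComplex

variable (F : MinimalComplex V k)

/-- The chains of the Koszul complex of the variables with coefficients in the `q`-th module. -/
abbrev Chain (q : ℕ) : Type := Finset V → F.ι q →₀ MvPolynomial V k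

/-- The differential of the complex on Koszul chains. -/
def dK (q : ℕ) : F.Chain (q + 1) →ₗ[MvPolynomial V k] F.Chain q := (F.d q).compLeft (Finset V)

variable {F}

lemma dK_apply {q : ℕ} (f : F.Chain (q + 1)) (σ : Finset V) : F.dK q f σ = F.d q (f σ) := rfl

lemma exists_dK_eq {q : ℕ} {f : F.Chain (q + 1)} (hf : F.dK q f = 0) :
    ∃ g, F.dK (q + 1) g = f := by
  choose g hg using fun σ => F.exact q (f σ) (congrFun hf σ)
  exact ⟨g, funext hg⟩

lemma dK_dK {q : ℕ} (f : F.Chain (q + 2)) : F.dK q (F.dK (q + 1) f) = 0 :=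
  funext fun σ => F.d_d q (f σ)

lemma coeff_zero_d {q : ℕ} (v : F.ι (q + 1) →₀ MvPolynomial V k) (b : F.ι q) :
    coeff 0 (F.d q v b) = 0 := by
  by_contra h
  obtain ⟨a, β₁, β₂, h1, -, h2⟩ := coeff_map_ne_zero h
  rw [(add_eq_zero.1 h1).2] at h2
  exact h2 (F.minimal q a b)

/-- The chain has homological degree `p` and internal degree `j`. -/
def IsHomogeneousChain {q : ℕ} (p j : ℕ) (y : F.Chain q) : Prop :=
  ∀ σ b β, coeff β (y σ b) ≠ 0 → σ.card = p ∧ β.degree + F.deg q b + p = j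

lemma IsHomogeneousChain.dK {q p j : ℕ} {y : F.Chain (q + 1)} (hy : IsHomogeneousChain p j y) :
    IsHomogeneousChain p j (F.dK q y) := fun σ b β h => by
  obtain ⟨a, β₁, β₂, rfl, h1, h2⟩ := coeff_map_ne_zero h
  have h3 := F.homog q a b β₂ h2
  obtain ⟨h4, h5⟩ := hy σ a β₁ h1
  exact ⟨h4, by rw [map_add]; omega⟩

/-- The basis vector `a`, as a Koszul chain of homological degree zero. -/
def basisChain [DecidableEq V] {q : ℕ} (a : F.ι q) : F.Chain q := fun σ =>
  if σ = ∅ then Finsupp.single a 1 else 0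

lemma basisChain_ne_zero [DecidableEq V] {q : ℕ} (a : F.ι q) (σ : Finset V)
    (h : F.basisChain a σ ≠ 0) :
    σ.card = 0 := by
  unfold basisChain at h
  split_ifs at h with h1
  · simp [h1]
  · exact absurd rfl h

variable [Fintype V] [LinearOrder V]

lemma koszul_dK {q : ℕ} (f : F.Chain (q + 1)) :
    koszul (X : V → MvPolynomial V k) (F.dK q f) =
      F.dK q (koszul (X : V → MvPolynomial V k) f) :=
  koszul_comp_map X (F.d q) f

lemma coeff_zero_koszul {q : ℕ} (f : F.Chain q) (σ : Finset V) (b : F.ι q) :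
    coeff 0 (koszul (X : V → MvPolynomial V k) f σ b) = 0 := by
  rw [koszul_apply, Finsupp.finsetSum_apply, coeff_sum]
  refine Finset.sum_eq_zero fun v _ => ?_
  rw [Finsupp.smul_apply, coeff_zsmul', Finsupp.smul_apply, smul_eq_mul, coeff_X_mul']
  simp

/-- The chain is a boundary in the Koszul complex of the cokernel of `F.d q`. -/
def IsRelBoundary {q : ℕ} (y : F.Chain q) : Prop :=
  ∃ g h, y = koszul (X : V → MvPolynomial V k) g + F.dK q h

/-- The chains `y` and `z` are the ends of a zigzag in the double complex. -/
def Zigzag : ∀ q : ℕ, F.Chain q → F.Chain 0 → Prop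
  | 0, y, z => y = z
  | q + 1, y, z => ∃ y' : F.Chain q,
      F.dK q y = koszul (X : V → MvPolynomial V k) y' ∧ y' ∅ = 0 ∧ Zigzag q y' z

lemma Zigzag.add_smul : ∀ {q : ℕ} {y y' : F.Chain q} {z z' : F.Chain 0} (_ : Zigzag q y z)
    (_ : Zigzag q y' z') (r : MvPolynomial V k), Zigzag q (y + r • y') (z + r • z')
  | 0, _, _, _, _, h, h', r => by
    unfold Zigzag at h h' ⊢
    rw [h, h']
  | q + 1, _, _, _, _, ⟨u, h1, h2, h3⟩, ⟨u', h1', h2', h3'⟩, r =>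
    ⟨u + r • u', by rw [map_add, map_add, map_smul, map_smul, h1, h1'], by simp [h2, h2'],
      h3.add_smul h3' r⟩

lemma Zigzag.add_sum_smul {q : ℕ} {y : F.Chain q} {z : F.Chain 0} (h : Zigzag q y z) {κ : Type}
    {y' : κ → F.Chain q} {z' : κ → F.Chain 0} (h' : ∀ a, Zigzag q (y' a) (z' a))
    (r : κ → MvPolynomial V k) (s : Finset κ) :
    Zigzag q (y + ∑ a ∈ s, r a • y' a) (z + ∑ a ∈ s, r a • z' a) := by
  classical
  induction s using Finset.induction_on with
  | empty => simpa using h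
  | insert a s ha ih =>
    rw [Finset.sum_insert ha, Finset.sum_insert ha, add_comm (r a • y' a), add_comm (r a • z' a),
      ← add_assoc, ← add_assoc]
    exact ih.add_smul (h' a) (r a)

lemma Zigzag.isRelBoundary_left : ∀ {q : ℕ} {y : F.Chain q} {z : F.Chain 0} (_ : Zigzag q y z)
    (_ : IsRelBoundary z), IsRelBoundary y
  | 0, _, _, h, hz => by
    unfold Zigzag at h
    rwa [h]
  | q + 1, y, _, ⟨u, h1, _, h3⟩, hz => by
    obtain ⟨g, h, rfl⟩ := h3.isRelBoundary_left hz
    rw [map_add, koszul_koszul, zero_add, koszul_dK, ← sub_eq_zero, ← map_sub] at h1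
    obtain ⟨v, hv⟩ := exists_dK_eq h1
    exact ⟨h, v, by rw [hv]; abel⟩

lemma Zigzag.isRelBoundary_right : ∀ {q : ℕ} {y : F.Chain q} {z : F.Chain 0}
    (_ : Zigzag q y z) (_ : IsRelBoundary y), IsRelBoundary z
  | 0, _, _, h, hy => by
    unfold Zigzag at h
    rwa [← h]
  | q + 1, _, _, ⟨u, h1, h2, h3⟩, ⟨g, h, hy⟩ => by
    refine h3.isRelBoundary_right ?_
    rw [hy, map_add, dK_dK, add_zero, ← koszul_dK, ← sub_eq_zero, ← map_sub] at h1
    obtain ⟨v, hv, -⟩ := exists_koszul_eq_finsupp h1 fun b => by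
      rw [Pi.sub_apply, h2, sub_zero]
      exact coeff_zero_d _ b
    exact ⟨-v, g, by rw [map_neg, hv]; abel⟩

lemma Zigzag.exists_koszul_eq : ∀ {q : ℕ} {y : F.Chain (q + 1)} {z : F.Chain 0}
    (_ : Zigzag (q + 1) y z), ∃ h, koszul (X : V → MvPolynomial V k) z = F.dK 0 h
  | 0, y, _, ⟨_, h1, _, h3⟩ => by
    unfold Zigzag at h3
    exact ⟨y, by rw [← h3, h1]⟩
  | _ + 1, _, _, ⟨_, _, _, h3⟩ => h3.exists_koszul_eq

lemma IsHomogeneousChain.exists_koszul_eq {q p j : ℕ} {f : F.Chain q}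
    (hf : IsHomogeneousChain p j f) (hk : koszul (X : V → MvPolynomial V k) f = 0)
    (h0 : ∀ b, coeff 0 (f ∅ b) = 0) :
    ∃ g, koszul (X : V → MvPolynomial V k) g = f ∧ g ∅ = 0 ∧ IsHomogeneousChain (p + 1) j g := by
  obtain ⟨g, hg, hg'⟩ := exists_koszul_eq_finsupp hk h0
  refine ⟨g, hg, ?_, fun σ b β h => ?_⟩
  · ext b β
    by_contra h
    obtain ⟨v, hv, -⟩ := hg' ∅ b β h
    simp at hv
  · obtain ⟨v, hv, h⟩ := hg' σ b β h
    obtain ⟨h1, h2⟩ := hf _ b _ h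
    rw [map_add, Finsupp.degree_single] at h2
    have := Finset.card_erase_add_one hv
    omega

lemma exists_zigzag_of_left : ∀ {q p j : ℕ} {y : F.Chain (q + 1)} (_ : IsHomogeneousChain p j y)
    (_ : koszul (X : V → MvPolynomial V k) (F.dK q y) = 0),
    ∃ z : F.Chain 0, IsHomogeneousChain (p + q + 1) j z ∧ Zigzag (q + 1) y z := by
  intro q
  induction q with
  | zero =>
    intro p j y hy hd
    obtain ⟨z, hz, h0, hz'⟩ := hy.dK.exists_koszul_eq hd fun b => coeff_zero_d _ b
    exact ⟨z, hz', z, hz.symm, h0, rfl⟩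
  | succ q ih =>
    intro p j y hy hd
    obtain ⟨y', hy', h0, hh⟩ := hy.dK.exists_koszul_eq hd fun b => coeff_zero_d _ b
    obtain ⟨z, hz, h⟩ := ih hh (by rw [koszul_dK, hy', dK_dK])
    exact ⟨z, by convert hz using 1; ring, y', hy'.symm, h0, h⟩

lemma exists_zigzag_of_right : ∀ {q p : ℕ} {z : F.Chain 0} (_ : ∀ σ, z σ ≠ 0 → σ.card = p + q)
    (_ : ∃ h, koszul (X : V → MvPolynomial V k) z = F.dK 0 h),
    ∃ y : F.Chain q, (∀ σ, y σ ≠ 0 → σ.card = p) ∧ Zigzag q y z ∧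
      ∃ h, koszul (X : V → MvPolynomial V k) y = F.dK q h := by
  intro q
  induction q with
  | zero => exact fun hz hd => ⟨_, hz, rfl, hd⟩
  | succ q ih =>
    intro p z hz hd
    obtain ⟨y', h1, h2, h, h3⟩ := ih (p := p + 1) (z := z)
      (fun σ hσ => by rw [hz σ hσ]; ring) hd
    let y : F.Chain (q + 1) := fun σ => if σ.card = p then h σ else 0
    have hy : F.dK q y = koszul (X : V → MvPolynomial V k) y' := by
      funext σ
      by_cases hσ : σ.card = p
      · rw [h3, dK_apply, dK_apply]
        simp [y, hσ]
      · rw [dK_apply]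
        simp only [y, hσ, if_false, map_zero]
        by_contra hne
        obtain ⟨v, hv, hne⟩ := exists_ne_zero_of_koszul_ne_zero (Ne.symm hne)
        have := h1 _ hne
        rw [Finset.card_insert_of_notMem hv] at this
        omega
    refine ⟨y, fun σ hσ => ?_, ⟨y', hy, ?_, h2⟩, ?_⟩
    · by_contra h'
      simp [y, h'] at hσ
    · by_contra h'
      simpa using h1 _ h'
    · have : F.dK q (koszul (X : V → MvPolynomial V k) y) = 0 := by
        rw [← koszul_dK, hy, koszul_koszul]
      obtain ⟨g, hg⟩ := exists_dK_eq this
      exact ⟨g, hg.symm⟩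

lemma koszul_eq_zero_of_card {q : ℕ} {y : F.Chain q} (hy : ∀ σ, y σ ≠ 0 → σ.card = 0) :
    koszul (X : V → MvPolynomial V k) y = 0 := by
  funext σ
  by_contra h
  obtain ⟨v, hv, h⟩ := exists_ne_zero_of_koszul_ne_zero h
  simpa using hy _ h

lemma exists_zigzag_basisChain {q : ℕ} (a : F.ι (q + 1)) : ∃ z : F.Chain 0,
    IsHomogeneousChain (q + 1) (F.deg (q + 1) a) z ∧ Zigzag (q + 1) (F.basisChain a) z := by
  classical
  have h1 : IsHomogeneousChain 0 (F.deg (q + 1) a) (F.basisChain a) := fun σ b β h => by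
    have h0 : σ = ∅ := by
      by_contra h0
      simp [basisChain, h0] at h
    subst h0
    rw [basisChain, if_pos rfl, Finsupp.single_apply] at h
    split_ifs at h with hb
    · subst hb
      rw [coeff_one] at h
      split_ifs at h with hβ
      · subst hβ; simp
      · exact absurd rfl h
    · simp at h
  obtain ⟨z, hz, h⟩ := exists_zigzag_of_left h1
    (by rw [koszul_dK, koszul_eq_zero_of_card (basisChain_ne_zero a), map_zero])
  exact ⟨z, by simpa using hz, h⟩

lemma not_isRelBoundary_basisChain {q : ℕ} (a : F.ι q) : ¬ IsRelBoundary (F.basisChain a) := by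
  rintro ⟨g, h, e⟩
  have h1 := congrArg (coeff 0) (DFunLike.congr_fun (congrFun e ∅) a)
  rw [Pi.add_apply, Finsupp.add_apply, coeff_add, coeff_zero_koszul, dK_apply, coeff_zero_d] at h1
  simp [basisChain] at h1

/-- Each Koszul cycle of degree `q + 1` over the cokernel of `F.d 0` is a combination of the cycles
coming from the basis of the `(q + 1)`-st module, up to a term which is zero at the top. -/
lemma exists_combination {q : ℕ} {z : F.Chain 0}
    (hz : ∀ σ, z σ ≠ 0 → σ.card = q + 1)
    (hd : ∃ h, koszul (X : V → MvPolynomial V k) z = F.dK 0 h) :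
    ∃ (s : Finset (F.ι (q + 1))) (c : F.ι (q + 1) → k) (z' : F.ι (q + 1) → F.Chain 0),
      (∀ a, IsHomogeneousChain (q + 1) (F.deg (q + 1) a) (z' a)) ∧
      ∃ u, z Finset.univ + ∑ a ∈ s, (C (c a) : MvPolynomial V k) • z' a Finset.univ =
        F.d 0 u := by
  classical
  obtain ⟨y, hy, hyz, -⟩ := exists_zigzag_of_right (q := q + 1) (p := 0) (z := z)
    (by simpa using hz) hd
  choose z' hz' hzz using fun a => F.exists_zigzag_basisChain (q := q) a
  let s := (y ∅).support
  let c : F.ι (q + 1) → k := fun a => -coeff 0 (y ∅ a)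
  have h := hyz.add_sum_smul hzz (fun a => C (c a)) s
  refine ⟨s, c, z', hz', ?_⟩
  have h0 : IsRelBoundary (y + ∑ a ∈ s, (C (c a) : MvPolynomial V k) • F.basisChain a) := by
    have hk : koszul (X : V → MvPolynomial V k)
        (y + ∑ a ∈ s, (C (c a) : MvPolynomial V k) • F.basisChain a) = 0 := by
      rw [map_add, map_sum, koszul_eq_zero_of_card hy, zero_add]
      refine Finset.sum_eq_zero fun a _ => ?_
      rw [map_smul, koszul_eq_zero_of_card (basisChain_ne_zero a), smul_zero]
    obtain ⟨g, hg, -⟩ := exists_koszul_eq_finsupp hk fun b => by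
      rw [Pi.add_apply, Finsupp.add_apply, coeff_add, Finset.sum_apply,
        Finsupp.finsetSum_apply, coeff_sum, Finset.sum_eq_single b]
      · simp [basisChain, c]
      · intro a _ hab
        simp [basisChain, hab]
      · intro hb
        have : y ∅ b = 0 := by simpa [s] using hb
        simp [c, this]
    exact ⟨g, 0, by rw [hg, map_zero, add_zero]⟩
  obtain ⟨g, u, e⟩ := h.isRelBoundary_right h0
  refine ⟨u Finset.univ, ?_⟩
  have := congrFun e Finset.univ
  rw [Pi.add_apply, Pi.add_apply, koszul_apply, Finset.compl_univ, Finset.sum_empty,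
    zero_add, Finset.sum_apply] at this
  exact this

end MinimalComplex

end Resolution

section Regularity

variable {V k : Type} [Field k]

namespace MinFreeRes

variable {I : Ideal (MvPolynomial V k)} (R : MinFreeRes I)

/-- The bases of the resolution, augmented by the basis of the polynomial ring. -/
def augι : ℕ → Type
  | 0 => Unit
  | i + 1 => R.ι i

/-- The degrees of the basis elements. -/
def augDeg : ∀ i, R.augι i → ℕ
  | 0 => fun _ => 0
  | i + 1 => R.deg i

/-- The maps of the resolution of the quotient by `I`. -/
def augD : ∀ i, (R.augι (i + 1) →₀ MvPolynomial V k) →ₗ[MvPolynomial V k]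
    (R.augι i →₀ MvPolynomial V k)
  | 0 => Finsupp.lsingle () ∘ₗ R.aug
  | i + 1 => R.d i

lemma mem_iff_exists_aug {p : MvPolynomial V k} : p ∈ I ↔ ∃ u, R.aug u = p := by
  rw [← LinearMap.mem_range, R.aug_range]

lemma degree_eq_of_isHomogeneous {p : MvPolynomial V k} {n : ℕ} (hp : p.IsHomogeneous n)
    {β : V →₀ ℕ} (h : coeff β p ≠ 0) : β.degree = n := by
  rw [Finsupp.degree_eq_weight_one]
  exact hp h

lemma coeff_zero_of_mem_mIdeal {p : MvPolynomial V k} (h : p ∈ mIdeal k V) : coeff 0 p = 0 := by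
  have : mIdeal k V ≤ RingHom.ker (constantCoeff (σ := V) (R := k)) := by
    refine Ideal.span_le.2 ?_
    rintro _ ⟨v, rfl⟩
    simp
  exact this h

/-- The minimal resolution of the quotient by `I`. -/
def toMinimalComplex (hI : ∀ p ∈ I, coeff 0 p = 0) : MinimalComplex V k where
  ι := R.augι
  deg := R.augDeg
  d := R.augD
  exact
    | 0, v, h => by
      have h : v ∈ LinearMap.ker R.aug := Finsupp.single_eq_zero.1 h
      rw [← R.exact_zero] at h
      exact h
    | i + 1, v, h => by
      have h : v ∈ LinearMap.ker (R.d i) := h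
      rw [← R.exact_succ] at h
      exact h
  d_d
    | 0, u => by
      have h : R.d 0 u ∈ LinearMap.range (R.d 0) := ⟨u, rfl⟩
      rw [R.exact_zero] at h
      exact Finsupp.single_eq_zero.2 h
    | i + 1, u => by
      have h : R.d (i + 1) u ∈ LinearMap.range (R.d (i + 1)) := ⟨u, rfl⟩
      rw [R.exact_succ] at h
      exact h
  homog
    | 0, a, (), β, h => by
      have h : coeff β (Finsupp.single () (R.aug (Finsupp.single a 1)) ()) ≠ 0 := h
      rw [Finsupp.single_eq_same] at h
      rw [degree_eq_of_isHomogeneous (R.aug_homog a) h]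
      exact (zero_add _).symm
    | i + 1, a, b, β, h => by
      have h : coeff β (R.d i (Finsupp.single a 1) b) ≠ 0 := h
      obtain h0 | ⟨e, he, hh⟩ := R.d_homog i a b
      · exact absurd (by rw [h0, coeff_zero]) h
      · rw [degree_eq_of_isHomogeneous hh h]
        exact he
  minimal
    | 0, a, () => by
      have h : coeff 0 (Finsupp.single () (R.aug (Finsupp.single a 1)) ()) = 0 := by
        rw [Finsupp.single_eq_same]
        exact hI _ (R.mem_iff_exists_aug.2 ⟨_, rfl⟩)
      exact h
    | i + 1, a, b => coeff_zero_of_mem_mIdeal (R.minimal i a b)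

lemma exists_minimalComplex (hI : ∀ p ∈ I, coeff 0 p = 0) :
    ∃ (F : MinimalComplex V k) (o : F.ι 0), F.deg 0 o = 0 ∧
      (∀ v, (∃ u, F.d 0 u = v) ↔ v o ∈ I) ∧
      ∀ i j, (∃ a, F.deg (i + 1) a = j) ↔ ∃ a, R.deg i a = j := by
  refine ⟨R.toMinimalComplex hI, (), rfl, fun v => ?_, fun i j => Iff.rfl⟩
  rw [R.mem_iff_exists_aug]
  refine exists_congr fun u => ⟨fun h => ?_, fun h => ?_⟩
  · rw [← h]
    exact (Finsupp.single_eq_same (a := ()) (b := R.aug u)).symm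
  · refine Finsupp.ext fun _ => ?_
    exact (Finsupp.single_eq_same (a := ()) (b := R.aug u)).trans h

variable {R}

lemma betti_ne_zero_iff {i j : ℕ} : R.betti i j ≠ 0 ↔ ∃ a, R.deg i a = j := by
  have := R.finite i
  rw [betti, Nat.card_ne_zero]
  exact ⟨fun ⟨⟨a⟩, _⟩ => ⟨a, a.2⟩, fun ⟨a, h⟩ => ⟨⟨a, h⟩, inferInstance⟩⟩

end MinFreeRes

namespace MinimalComplex

variable {F : MinimalComplex V k} {o : F.ι 0} {I : Ideal (MvPolynomial V k)}

lemma exists_dK_zero_iff (hF : ∀ v, (∃ u, F.d 0 u = v) ↔ v o ∈ I) {z : F.Chain 0} :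
    (∃ h, z = F.dK 0 h) ↔ ∀ σ, z σ o ∈ I := by
  refine ⟨?_, fun h => ?_⟩
  · rintro ⟨h, rfl⟩ σ
    exact (hF _).1 ⟨h σ, rfl⟩
  · choose u hu using fun σ => (hF _).2 (h σ)
    exact ⟨u, (funext hu).symm⟩

variable [Fintype V] [LinearOrder V]

lemma koszul_comp_apply (z : F.Chain 0) (σ : Finset V) :
    koszul (X : V → MvPolynomial V k) z σ o =
      koszul (X : V → MvPolynomial V k) (fun σ => z σ o) σ :=
  (congrFun (koszul_comp_map X (Finsupp.lapply (R := MvPolynomial V k) o) z) σ).symm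

lemma isRelBoundary_of_sub_mem (hF : ∀ v, (∃ u, F.d 0 u = v) ↔ v o ∈ I) {z : F.Chain 0}
    {g : Finset V → MvPolynomial V k}
    (h : ∀ σ, ((fun σ => z σ o) - koszul (X : V → MvPolynomial V k) g) σ ∈ I) :
    IsRelBoundary z := by
  let g' : F.Chain 0 := fun σ => Finsupp.single o (g σ)
  obtain ⟨u, hu⟩ := (exists_dK_zero_iff hF
    (z := z - koszul (X : V → MvPolynomial V k) g')).2 fun σ => by
      rw [Pi.sub_apply, Finsupp.sub_apply, koszul_comp_apply]
      simpa [g'] using h σ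
  exact ⟨g', u, by rw [← hu]; abel⟩

end MinimalComplex

lemma mem_edgeIdeal_iff {part : V → Fin 3} {E : Set (V × V)}
    (hE : E = {p : V × V | (part p.2 : ℕ) = ((part p.1 : ℕ) + 1) % 3}) {w : V → ℕ}
    {p : MvPolynomial V k} :
    p ∈ edgeIdeal k E w ↔ ∀ β, coeff β p ≠ 0 → IsEdgeExponent part w β := by
  have h : edgeIdeal k E w = Ideal.span ((fun s => monomial s (1 : k)) ''
      ((fun e : V × V => Finsupp.single e.1 1 + Finsupp.single e.2 (w e.2)) '' E)) := by
    rw [edgeIdeal, Set.image_image]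
    congr 1
    ext q
    simp only [Set.mem_ofPred_eq, Set.mem_image]
    refine exists_congr fun e => and_congr_right fun _ => ?_
    rw [monomial_add_single, ← X, eq_comm]
  classical
  rw [h, mem_ideal_span_monomial_image]
  simp only [mem_support_iff, Set.exists_mem_image]
  refine forall₂_congr fun β _ => ?_
  have hpart : ∀ i j : Fin 3, (j : ℕ) = ((i : ℕ) + 1) % 3 ↔ j = i + 1 := by decide
  rw [IsEdgeExponent, Prod.exists]
  refine exists₂_congr fun x y => ?_
  rw [hE, Set.mem_ofPred_eq, hpart]
  refine and_congr_right fun hxy => ⟨fun h => ?_, fun h v => ?_⟩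
  · constructor
    · have := h x
      simp at this
      omega
    · have := h y
      simp at this
      omega
  · have hne : x ≠ y := by
      rintro rfl
      exact absurd hxy (by simp)
    rw [Finsupp.add_apply, Finsupp.single_apply, Finsupp.single_apply]
    split_ifs with h1 h2 h2
    · exact absurd (h1.trans h2.symm) hne
    · subst h1; simpa using h.1
    · subst h2; simpa using h.2
    · simp

end Regularity

section Tripartite

variable {V k : Type} [Field k] {part : V → Fin 3} {E : Set (V × V)} {w : V → ℕ}

lemma coeff_zero_of_mem_edgeIdeal
    (hE : E = {p : V × V | (part p.2 : ℕ) = ((part p.1 : ℕ) + 1) % 3})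
    (p : MvPolynomial V k) (hp : p ∈ edgeIdeal k E w) : coeff 0 p = 0 := by
  by_contra h
  obtain ⟨x, y, -, hx, -⟩ := (mem_edgeIdeal_iff hE).1 hp 0 h
  simp at hx

variable [Fintype V]

lemma deg_le (hE : E = {p : V × V | (part p.2 : ℕ) = ((part p.1 : ℕ) + 1) % 3})
    (hw : ∀ x, 2 ≤ w x) (R : MinFreeRes (edgeIdeal k E w)) (i : ℕ) (a : R.ι i) :
    R.deg i a ≤ ∑ x, (w x - 1) + 1 + i := by
  let _ : LinearOrder V := LinearOrder.lift' (Fintype.equivFin V) (Equiv.injective _)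
  by_contra! hlt
  obtain ⟨F, o, hdeg, hF, hR⟩ := R.exists_minimalComplex (coeff_zero_of_mem_edgeIdeal hE)
  obtain ⟨a', ha⟩ := (hR i _).2 ⟨a, rfl⟩
  obtain ⟨z, hz, h⟩ := F.exists_zigzag_basisChain a'
  obtain ⟨g, hg⟩ := exists_koszul_of_lt_degree (part := part) hw (f := fun σ => z σ o)
    (fun σ β h => by
      have h1 := (hz σ o β h).2
      omega) fun σ β => by
        rw [← F.koszul_comp_apply]
        exact (mem_edgeIdeal_iff hE).1 ((F.exists_dK_zero_iff hF).1 h.exists_koszul_eq σ) β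
  exact F.not_isRelBoundary_basisChain a' (h.isRelBoundary_left
    (F.isRelBoundary_of_sub_mem hF fun σ => (mem_edgeIdeal_iff hE).2 (hg σ)))

/-- The exponent of the monomial which spans the part of top degree of the socle of the quotient
by the edge ideal. -/
def socleExponent (w : V → ℕ) : V →₀ ℕ := Finsupp.equivFunOnFinite.symm fun x => w x - 1

lemma exists_deg_eq (hpart : ∀ i : Fin 3, ∃ x : V, part x = i)
    (hE : E = {p : V × V | (part p.2 : ℕ) = ((part p.1 : ℕ) + 1) % 3})
    (hw : ∀ x, 2 ≤ w x) (R : MinFreeRes (edgeIdeal k E w)) {q : ℕ}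
    (hq : Fintype.card V = q + 1) : ∃ a : R.ι q, R.deg q a = ∑ x, (w x - 1) + 1 + q := by
  let _ : LinearOrder V := LinearOrder.lift' (Fintype.equivFin V) (Equiv.injective _)
  obtain ⟨F, o, hdeg, hF, hR⟩ := R.exists_minimalComplex (coeff_zero_of_mem_edgeIdeal hE)
  set m := socleExponent w with hm
  have hmx : ∀ x, m x = w x - 1 := fun x => rfl
  have hmE : ¬ IsEdgeExponent part w m := by
    rintro ⟨x, y, -, -, h⟩
    rw [hmx] at h
    have := hw y
    omega
  let z : F.Chain 0 := fun σ => if σ = Finset.univ then Finsupp.single o (monomial m 1) else 0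
  have hz : ∀ σ, z σ ≠ 0 → σ = Finset.univ := fun σ h => by
    by_contra h'
    simp [z, h'] at h
  have hd : ∀ σ, koszul (X : V → MvPolynomial V k) (fun σ => z σ o) σ ∈ edgeIdeal k E w := by
    intro σ
    rw [koszul_apply]
    refine sum_mem fun v _ => zsmul_mem ?_ _
    rw [mem_edgeIdeal_iff hE]
    intro β h
    by_cases hσ : insert v σ = Finset.univ
    · simp only [z, hσ, if_true, Finsupp.single_eq_same, smul_eq_mul] at h
      rw [X, monomial_mul, coeff_monomial] at h
      split_ifs at h with hβ
      · obtain ⟨x, hx⟩ := hpart (part v - 1)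
        have h1 := hw x
        have h2 := hw v
        have h3 := hmx x
        have h4 := hmx v
        refine ⟨x, v, by rw [hx, sub_add_cancel], ?_, ?_⟩
        · rw [← hβ, Finsupp.add_apply]; omega
        · rw [← hβ, Finsupp.add_apply, Finsupp.single_eq_same]; omega
      · exact absurd rfl h
    · simp [z, hσ] at h
  obtain ⟨s, c, z', hz', u, hu⟩ := F.exists_combination (q := q) (z := z)
    (fun σ h => by rw [hz σ h, Finset.card_univ, hq])
    ((F.exists_dK_zero_iff hF).2 fun σ => by rw [F.koszul_comp_apply]; exact hd σ)
  have h1 := (mem_edgeIdeal_iff hE).1 ((hF _).1 ⟨u, hu.symm⟩) m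
  rw [← hR]
  by_contra! hne
  refine hmE (h1 ?_)
  have h2 : ∀ a, coeff m (z' a Finset.univ o) = 0 := fun a => by
    by_contra h
    have h3 : _ := (hz' a _ o m h).2
    have h4 : m.degree = ∑ x, (w x - 1) := Finsupp.degree_eq_sum m
    exact hne a (by omega)
  have h5 : coeff m (z Finset.univ o) = 1 := by simp [z]
  have h6 : coeff m ((∑ a ∈ s, (C (c a) : MvPolynomial V k) • z' a Finset.univ) o) = 0 := by
    rw [Finsupp.finsetSum_apply, coeff_sum]
    refine Finset.sum_eq_zero fun a _ => ?_
    rw [Finsupp.smul_apply, smul_eq_mul, coeff_C_mul, h2, mul_zero]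
  rw [Finsupp.add_apply, coeff_add, h5, h6, add_zero]
  exact one_ne_zero

end Tripartite
end WOG

/-- **Corollary (complete tripartite, regularity).**
`D` is a vertex-weighted oriented complete tripartite graph: the vertex set
is partitioned into nonempty parts `V_1, V_2, V_3` (encoded by
`part : V → Fin 3`), and the edges are exactly all pairs from `V_1` to `V_2`,
all pairs from `V_2` to `V_3` and all pairs from `V_3` to `V_1`.
All weights are `≥ 2`.  Then `reg I(D) = (∑_{x ∈ V} w(x)) - |V| + 1`. -/
theorem complete_tripartite_reg (k : Type) [Field k]
    (V : Type) [Fintype V] (part : V → Fin 3) (hpart : ∀ i : Fin 3, ∃ x : V, part x = i)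
    (E : Set (V × V))
    (hE : E = {p : V × V | (part p.2 : ℕ) = ((part p.1 : ℕ) + 1) % 3})
    (w : V → ℕ) (hw2 : ∀ x : V, 2 ≤ w x)
    (R : WOG.MinFreeRes (WOG.edgeIdeal k E w)) :
    IsGreatest R.regSet ((∑ x : V, (w x : ℤ)) - (Fintype.card V : ℤ) + 1) := by
  obtain ⟨x, -⟩ := hpart 0
  obtain ⟨q, hq⟩ : ∃ q, Fintype.card V = q + 1 :=
    Nat.exists_eq_succ_of_ne_zero (Fintype.card_pos_iff.2 ⟨x⟩).ne'
  have hsum : ∑ x, (w x : ℤ) = ((∑ x, (w x - 1) : ℕ) : ℤ) + Fintype.card V := by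
    have : ∑ x, w x = ∑ x, (w x - 1) + Fintype.card V := by
      rw [← Finset.card_univ, Finset.card_eq_sum_ones, ← Finset.sum_add_distrib]
      exact Finset.sum_congr rfl fun x _ => by have := hw2 x; omega
    exact_mod_cast this
  rw [hsum]
  refine ⟨?_, ?_⟩
  · obtain ⟨a, ha⟩ := WOG.exists_deg_eq hpart hE hw2 R hq
    exact ⟨q, _, WOG.MinFreeRes.betti_ne_zero_iff.2 ⟨a, ha⟩, by push_cast; ring⟩
  · rintro _ ⟨i, j, h, rfl⟩
    obtain ⟨a, rfl⟩ := WOG.MinFreeRes.betti_ne_zero_iff.1 h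
    have := WOG.deg_le hE hw2 R i a
    omega
end
end

section
/- Let D = (V,E,w) be a vertex-weighted oriented complete tripartite graph with parts V = V_1 ⊔ V_2 ⊔ V_3 (all nonempty), whose edges are exactly all pairs between V_1 and V_2 directed from V_1 to V_2, all pairs between V_2 and V_3 directed from V_2 to V_3, and all pairs between V_3 and V_1 directed from V_3 to V_1. If w(x) ≥ 2 for every vertex x, then pd(I(D)) = |V| − 1. -/
open MvPolynomial

noncomputable section

section RegularSequences

variable {R : Type*} [CommRing R]

/-- The ideal generated by the first `i` terms of a sequence. -/
def initialIdeal (x : ℕ → R) (i : ℕ) : Ideal R := Ideal.span (x '' Set.Iio i)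

lemma initialIdeal_zero (x : ℕ → R) : initialIdeal x 0 = ⊥ := by
  simp [initialIdeal]

lemma initialIdeal_succ (x : ℕ → R) (i : ℕ) :
    initialIdeal x (i + 1) = Ideal.span {x i} ⊔ initialIdeal x i := by
  have h : Set.Iio (i + 1) = insert i (Set.Iio i) := by
    ext j
    simp only [Set.mem_Iio, Set.mem_insert_iff]
    omega
  rw [initialIdeal, initialIdeal, h, Set.image_insert_eq, Ideal.span_insert]

lemma mem_initialIdeal_succ_smul {M : Type*} [AddCommGroup M] [Module R M] (x : ℕ → R) (i : ℕ)
    (N : Submodule R M) (z : M) :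
    z ∈ initialIdeal x (i + 1) • N ↔ ∃ a ∈ N, ∃ b ∈ initialIdeal x i • N, z = x i • a + b := by
  rw [initialIdeal_succ, Submodule.sup_smul, Submodule.mem_sup]
  constructor
  · rintro ⟨y, hy, b, hb, rfl⟩
    obtain ⟨a, ha, rfl⟩ := (Submodule.mem_smul_pointwise_iff_exists _ _ _).1
      (Submodule.ideal_span_singleton_smul (x i) N ▸ hy)
    exact ⟨a, ha, b, hb, rfl⟩
  · rintro ⟨a, ha, b, hb, rfl⟩
    exact ⟨_, Submodule.smul_mem_smul (Ideal.mem_span_singleton_self _) ha, b, hb, rfl⟩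

/-- The first `i` terms of the sequence `x` form a weakly regular sequence on `N`. -/
def RegularUpTo {M : Type*} [AddCommGroup M] [Module R M] (x : ℕ → R) (i : ℕ)
    (N : Submodule R M) : Prop :=
  ∀ j < i, ∀ z ∈ N, x j • z ∈ initialIdeal x j • N → z ∈ initialIdeal x j • N

/-- `N / (x₀, …, xᵢ₋₁) N` contains a nonzero element annihilated by the ideal `m`. -/
def HasSocle {M : Type*} [AddCommGroup M] [Module R M] (m : Ideal R) (x : ℕ → R) (i : ℕ)
    (N : Submodule R M) : Prop :=
  ∃ z ∈ N, z ∉ initialIdeal x i • N ∧ ∀ r ∈ m, r • z ∈ initialIdeal x i • N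

variable {G P : Type*} [AddCommGroup G] [Module R G] [AddCommGroup P] [Module R P]

lemma exists_mem_smul_top_of_mem_smul_range (J : Ideal R) (f : G →ₗ[R] P) {z : P}
    (hz : z ∈ J • LinearMap.range f) : ∃ g ∈ J • (⊤ : Submodule R G), f g = z := by
  rwa [LinearMap.range_eq_map, ← Submodule.map_smul''] at hz

lemma map_mem_smul_range (J : Ideal R) (f : G →ₗ[R] P) {g : G}
    (hg : g ∈ J • (⊤ : Submodule R G)) : f g ∈ J • LinearMap.range f := by
  rw [LinearMap.range_eq_map, ← Submodule.map_smul'']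
  exact Submodule.mem_map_of_mem hg

lemma RegularUpTo.mem_smul_ker {x : ℕ → R} {i : ℕ} {f : G →ₗ[R] P}
    (h : RegularUpTo x i (LinearMap.range f)) {j : ℕ} (hj : j ≤ i) {g : G}
    (hg : g ∈ initialIdeal x j • (⊤ : Submodule R G)) (hf : f g = 0) :
    g ∈ initialIdeal x j • LinearMap.ker f := by
  induction j generalizing g with
  | zero => simpa [initialIdeal_zero] using hg
  | succ j ih =>
    obtain ⟨a, -, b, hb, rfl⟩ := (mem_initialIdeal_succ_smul x j _ g).1 hg
    have hfa : x j • f a ∈ initialIdeal x j • LinearMap.range f := by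
      have : x j • f a = -f b := by
        rw [map_add, map_smul] at hf
        exact eq_neg_of_add_eq_zero_left hf
      rw [this]
      exact neg_mem (map_mem_smul_range _ f hb)
    obtain ⟨c, hc, hca⟩ := exists_mem_smul_top_of_mem_smul_range _ f
      (h j hj (f a) (LinearMap.mem_range_self f a) hfa)
    have hker : a - c ∈ LinearMap.ker f := by simp [hca]
    refine (mem_initialIdeal_succ_smul x j _ _).2 ⟨a - c, hker, x j • c + b, ?_, ?_⟩
    · refine ih (by omega) (add_mem (Submodule.smul_mem _ _ hc) hb) ?_
      rw [map_add, map_smul, hca, ← map_smul, ← map_add, hf]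
    · rw [smul_sub]
      abel

lemma RegularUpTo.ker {x : ℕ → R} {i : ℕ} {f : G →ₗ[R] P}
    (h : RegularUpTo x i (LinearMap.range f))
    (hG : RegularUpTo x (i + 1) (⊤ : Submodule R G)) :
    RegularUpTo x (i + 1) (LinearMap.ker f) := fun j hj z hz hxz =>
  h.mem_smul_ker (by omega)
    (hG j hj z trivial (Submodule.smul_mono le_rfl le_top hxz)) hz

lemma HasSocle.ker {m : Ideal R} {x : ℕ → R} {i : ℕ} {f : G →ₗ[R] P}
    (hs : HasSocle m x i (LinearMap.range f)) (h : RegularUpTo x i (LinearMap.range f))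
    (hG : RegularUpTo x (i + 1) (⊤ : Submodule R G)) (hx : x i ∈ m) :
    HasSocle m x (i + 1) (LinearMap.ker f) := by
  obtain ⟨_, ⟨u, rfl⟩, hu, hm⟩ := hs
  have split : ∀ r ∈ m, ∃ g ∈ initialIdeal x i • (⊤ : Submodule R G),
      r • u - g ∈ LinearMap.ker f := by
    intro r hr
    obtain ⟨g, hg, hgr⟩ := exists_mem_smul_top_of_mem_smul_range _ f (hm r hr)
    exact ⟨g, hg, by simp [hgr]⟩
  obtain ⟨g, hg, hgk⟩ := split _ hx
  refine ⟨_, hgk, fun hmem => hu ?_, fun r hr => ?_⟩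
  · obtain ⟨a, ha, b, hb, hab⟩ := (mem_initialIdeal_succ_smul x i _ _).1 hmem
    have hua : u - a ∈ initialIdeal x i • (⊤ : Submodule R G) := by
      refine hG i (by omega) _ trivial ?_
      have : x i • (u - a) = b + g := by
        rw [smul_sub, sub_eq_iff_eq_add.1 hab]
        abel
      rw [this]
      exact add_mem (Submodule.smul_mono le_rfl le_top hb) hg
    have hfa : f a = 0 := ha
    simpa [hfa] using map_mem_smul_range _ f hua
  · obtain ⟨c, hc, hck⟩ := split r hr
    refine (mem_initialIdeal_succ_smul x i _ _).2
      ⟨r • u - c, hck, x i • c - r • g, h.mem_smul_ker le_rfl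
        (sub_mem (Submodule.smul_mem _ _ hc) (Submodule.smul_mem _ _ hg)) ?_, ?_⟩
    · have h₁ : r • f u = f c := by simpa [sub_eq_zero] using hck
      have h₂ : x i • f u = f g := by simpa [sub_eq_zero] using hgk
      rw [map_sub, map_smul, map_smul, ← h₁, ← h₂, smul_comm, sub_self]
    · rw [smul_sub, smul_sub, smul_comm r (x i) u]
      abel

lemma finsupp_mem_ideal_smul_top {ι : Type*} (J : Ideal R) (v : ι →₀ R) :
    v ∈ J • (⊤ : Submodule R (ι →₀ R)) ↔ ∀ b, v b ∈ J := by
  constructor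
  · intro h b
    exact Submodule.smul_induction_on h (fun r hr v _ => J.mul_mem_right _ hr)
      fun v v' hv hv' => J.add_mem hv hv'
  · intro h
    rw [← Finsupp.sum_single v]
    refine Submodule.sum_mem _ fun b _ => ?_
    rw [← mul_one (v b), ← smul_eq_mul, ← Finsupp.smul_single]
    exact Submodule.smul_mem_smul (h b) trivial

/-- Nakayama's lemma for submodules of a free module over a noetherian domain. -/
lemma submodule_finsupp_eq_bot_of_le_smul [IsNoetherianRing R] [IsDomain R] {ι : Type*}
    {m : Ideal R} (hm : m ≠ ⊤) {N : Submodule R (ι →₀ R)} (hN : N ≤ m • N) : N = ⊥ := by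
  have hpow : ∀ t : ℕ, N ≤ m ^ t • (⊤ : Submodule R (ι →₀ R)) := by
    intro t
    induction t with
    | zero => simp
    | succ t ih =>
      rw [pow_succ', mul_smul]
      exact hN.trans (Submodule.smul_mono le_rfl ih)
  rw [eq_bot_iff]
  intro v hv
  rw [Submodule.mem_bot]
  ext b
  have : v b ∈ (⨅ t : ℕ, m ^ t : Ideal R) :=
    Submodule.mem_iInf _ |>.2 fun t => (finsupp_mem_ideal_smul_top _ v).1 (hpow t hv) b
  rwa [Ideal.iInf_pow_eq_bot_of_isDomain m hm] at this

end RegularSequences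

namespace WOG

variable {k : Type} [Field k] {V : Type}

lemma mem_mIdeal_iff (p : MvPolynomial V k) : p ∈ mIdeal k V ↔ constantCoeff p = 0 := by
  rw [mIdeal, ← Set.image_univ, mem_ideal_span_X_image, constantCoeff_eq, ← notMem_support_iff]
  constructor
  · intro h h0
    obtain ⟨i, -, hi⟩ := h 0 h0
    exact hi rfl
  · intro h m hm
    by_contra! hc
    exact h ((Finsupp.ext fun i => hc i trivial : m = 0) ▸ hm)

lemma mIdeal_ne_top : mIdeal k V ≠ ⊤ := fun h => by
  have : (1 : MvPolynomial V k) ∈ mIdeal k V := h ▸ trivial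
  simp [mem_mIdeal_iff] at this

lemma mem_span_X_image_of_X_mul_mem {s : Set V} {v : V} (hv : v ∉ s) {p : MvPolynomial V k}
    (hp : X v * p ∈ Ideal.span (X '' s : Set (MvPolynomial V k))) :
    p ∈ Ideal.span (X '' s : Set (MvPolynomial V k)) := by
  classical
  rw [mem_ideal_span_X_image] at hp ⊢
  intro m hm
  obtain ⟨i, hi, hne⟩ := hp (Finsupp.single v 1 + m) (by
    rw [mem_support_iff, coeff_X_mul]
    exact mem_support_iff.1 hm)
  have hvi : v ≠ i := fun h => hv (h ▸ hi)
  exact ⟨i, hi, by simpa [Finsupp.single_apply, hvi] using hne⟩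

/-- Distinct variables form a regular sequence on every free module. -/
lemma regularUpTo_top_finsupp {v : ℕ → V} {n : ℕ} (hv : Set.InjOn v (Set.Iio n)) (ι : Type) :
    RegularUpTo (fun i => (X (v i) : MvPolynomial V k)) n
      (⊤ : Submodule (MvPolynomial V k) (ι →₀ MvPolynomial V k)) := by
  intro j hj z _ hz
  rw [finsupp_mem_ideal_smul_top] at hz ⊢
  intro b
  have hb := hz b
  rw [initialIdeal, ← Function.comp_def X v, Set.image_comp] at hb ⊢
  refine mem_span_X_image_of_X_mul_mem ?_ hb
  rintro ⟨l, hl, hlj⟩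
  have hl' : l < j := hl
  exact hl'.ne (hv (hl'.trans hj) hj hlj)

lemma regularUpTo_top {v : ℕ → V} {n : ℕ} (hv : Set.InjOn v (Set.Iio n)) :
    RegularUpTo (fun i => (X (v i) : MvPolynomial V k)) n
      (⊤ : Submodule (MvPolynomial V k) (MvPolynomial V k)) := by
  intro j hj z _ hz
  simp only [smul_eq_mul, Ideal.mul_top, initialIdeal, ← Function.comp_def X v,
    Set.image_comp] at hz ⊢
  refine mem_span_X_image_of_X_mul_mem ?_ hz
  rintro ⟨l, hl, hlj⟩
  have hl' : l < j := hl
  exact hl'.ne (hv (hl'.trans hj) hj hlj)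

namespace MinFreeRes

variable {I : Ideal (MvPolynomial V k)} (R : MinFreeRes I)

lemma range_d_le (i : ℕ) : LinearMap.range (R.d i) ≤ mIdeal k V • ⊤ := by
  rintro _ ⟨y, rfl⟩
  rw [← Finsupp.sum_single y, map_finsuppSum]
  refine Submodule.sum_mem _ fun a _ => ?_
  have hy : Finsupp.single a (y a) = y a • Finsupp.single a (1 : MvPolynomial V k) := by simp
  beta_reduce
  rw [hy, map_smul]
  exact Submodule.smul_mem _ _ ((finsupp_mem_ideal_smul_top _ _).2 (R.minimal i a))

lemma mem_pdSet_iff_s12 (i : ℕ) : i ∈ R.pdSet ↔ Nonempty (R.ι i) := by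
  have := R.finite i
  constructor
  · rintro ⟨j, hj⟩
    exact ⟨(Nat.card_ne_zero.1 hj).1.some.1⟩
  · rintro ⟨a⟩
    exact ⟨R.deg i a, Nat.card_ne_zero.2 ⟨⟨⟨a, rfl⟩⟩, inferInstance⟩⟩

lemma isEmpty_of_d_eq_zero {i : ℕ} (h : R.d i = 0) : IsEmpty (R.ι (i + 1)) := by
  refine ⟨fun a => mIdeal_ne_top (k := k) (V := V) ?_⟩
  have hmem : Finsupp.single a (1 : MvPolynomial V k) ∈ LinearMap.range (R.d (i + 1)) := by
    rw [R.exact_succ, h]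
    simp
  rw [Ideal.eq_top_iff_one]
  simpa using (finsupp_mem_ideal_smul_top _ _).1 (R.range_d_le _ hmem) a

lemma isEmpty_of_le {i j : ℕ} (hij : i ≤ j) (h : IsEmpty (R.ι i)) : IsEmpty (R.ι j) := by
  induction j, hij using Nat.le_induction with
  | base => exact h
  | succ j _ ih =>
    refine R.isEmpty_of_d_eq_zero (LinearMap.ext fun _ => Finsupp.ext fun b => ih.elim b)

/-- The syzygies in a resolution of `I` have regular sequences of variables, and a socle element
of `S / I` propagates along them. -/
lemma regularUpTo_range_d {v : ℕ → V} {n : ℕ} (hv : Set.InjOn v (Set.Iio n))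
    {u : MvPolynomial V k} (hu : u ∉ I) (huI : ∀ r ∈ mIdeal k V, r * u ∈ I)
    (i : ℕ) (hi : i + 2 ≤ n) :
    RegularUpTo (fun i => (X (v i) : MvPolynomial V k)) (i + 2) (LinearMap.range (R.d i)) ∧
      HasSocle (mIdeal k V) (fun i => (X (v i) : MvPolynomial V k)) (i + 2)
        (LinearMap.range (R.d i)) := by
  have hX : ∀ i, (X (v i) : MvPolynomial V k) ∈ mIdeal k V :=
    fun i => Ideal.subset_span ⟨v i, rfl⟩
  have hreg (t : ℕ) (ht : t ≤ n) (ι : Type) := regularUpTo_top_finsupp (k := k)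
    (hv.mono (Set.Iio_subset_Iio ht)) ι
  induction i with
  | zero =>
    have h₀ : RegularUpTo (fun i => (X (v i) : MvPolynomial V k)) 0
        (LinearMap.range I.mkQ) := fun j hj => absurd hj (Nat.not_lt_zero j)
    have s₀ : HasSocle (mIdeal k V) (fun i => (X (v i) : MvPolynomial V k)) 0
        (LinearMap.range I.mkQ) := by
      refine ⟨I.mkQ u, ⟨u, rfl⟩, ?_, fun r hr => ?_⟩
      · rwa [initialIdeal_zero, Submodule.bot_smul, Submodule.mem_bot, Submodule.mkQ_apply,
          Submodule.Quotient.mk_eq_zero]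
      · rw [← map_smul, smul_eq_mul, Submodule.mkQ_apply,
          (Submodule.Quotient.mk_eq_zero I).2 (huI r hr)]
        exact zero_mem _
    have t₀ := regularUpTo_top (k := k) (hv.mono (Set.Iio_subset_Iio (show 0 + 1 ≤ n by omega)))
    have h₁ := h₀.ker t₀
    have s₁ := s₀.ker h₀ t₀ (hX 0)
    rw [Submodule.ker_mkQ, ← R.aug_range] at h₁ s₁
    rw [R.exact_zero]
    exact ⟨h₁.ker (hreg 2 hi _), s₁.ker h₁ (hreg 2 hi _) (hX 1)⟩
  | succ i ih =>
    obtain ⟨h, s⟩ := ih (by omega)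
    rw [R.exact_succ]
    exact ⟨h.ker (hreg _ hi _), s.ker h (hreg _ hi _) (hX _)⟩

/-- If `S / I` has a nonzero socle, then `pd I` is one less than the number of variables. -/
theorem isGreatest_pdSet [Fintype V] (hV : 2 ≤ Fintype.card V)
    {u : MvPolynomial V k} (hu : u ∉ I) (huI : ∀ r ∈ mIdeal k V, r * u ∈ I) :
    IsGreatest R.pdSet (Fintype.card V - 1) := by
  obtain ⟨c, hc⟩ : ∃ c, Fintype.card V = c + 2 := ⟨_, (Nat.sub_add_cancel hV).symm⟩
  let e : Fin (c + 2) ≃ V := (Fintype.equivFinOfCardEq hc).symm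
  let v : ℕ → V := fun i => if h : i < c + 2 then e ⟨i, h⟩ else e 0
  have hve (i : ℕ) (h : i < c + 2) : v i = e ⟨i, h⟩ := dif_pos h
  have hinj : Set.InjOn v (Set.Iio (c + 2)) := by
    intro i hi j hj hij
    rw [hve i hi, hve j hj] at hij
    exact congrArg Fin.val (e.injective hij)
  have hJ : initialIdeal (fun i => (X (v i) : MvPolynomial V k)) (c + 2) = mIdeal k V := by
    rw [initialIdeal, mIdeal]
    congr 1
    ext p
    constructor
    · rintro ⟨i, -, rfl⟩
      exact ⟨v i, rfl⟩
    · rintro ⟨y, rfl⟩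
      refine ⟨e.symm y, (e.symm y).2, ?_⟩
      simp [hve _ (e.symm y).2]
  obtain ⟨h, z, hz, hzn, -⟩ := R.regularUpTo_range_d hinj hu huI c le_rfl
  rw [hc]
  refine ⟨(R.mem_pdSet_iff_s12 _).2 ?_, fun i hi => ?_⟩
  · by_contra hempty
    rw [not_nonempty_iff] at hempty
    obtain ⟨y, rfl⟩ := hz
    have : y = 0 := Finsupp.ext fun b => (hempty.elim b : _)
    simp [this] at hzn
  · by_contra! hlt
    have hker : LinearMap.ker (R.d c) ≤ mIdeal k V • LinearMap.ker (R.d c) := by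
      intro g hg
      have hg' := hg
      rw [← R.exact_succ] at hg'
      rw [← hJ]
      exact h.mem_smul_ker le_rfl (by rw [hJ]; exact R.range_d_le _ hg') hg
    have hbot := submodule_finsupp_eq_bot_of_le_smul mIdeal_ne_top hker
    rw [← R.exact_succ, LinearMap.range_eq_bot] at hbot
    exact not_isEmpty_iff.2 ((R.mem_pdSet_iff_s12 i).1 hi)
      (R.isEmpty_of_le (by omega) (R.isEmpty_of_d_eq_zero hbot))

end MinFreeRes

lemma mul_mem_of_mem_mIdeal {I : Ideal (MvPolynomial V k)} {u : MvPolynomial V k}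
    (h : ∀ x, X x * u ∈ I) {r : MvPolynomial V k} (hr : r ∈ mIdeal k V) : r * u ∈ I := by
  have hle : mIdeal k V ≤ Submodule.comap (LinearMap.mulRight (MvPolynomial V k) u) I := by
    rw [mIdeal, Ideal.span_le]
    rintro _ ⟨x, rfl⟩
    exact h x
  exact hle hr

lemma prod_X_pow_notMem_edgeIdeal [Fintype V] (E : Set (V × V)) {w : V → ℕ}
    (hw : ∀ x, 1 ≤ w x) : ∏ x, (X x : MvPolynomial V k) ^ (w x - 1) ∉ edgeIdeal k E w := by
  classical
  have hprod : ∏ x, (X x : MvPolynomial V k) ^ (w x - 1) =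
      monomial (Finsupp.equivFunOnFinite.symm fun x => w x - 1) 1 := by
    rw [monomial_eq, Finsupp.prod_fintype _ _ (by simp)]
    simp
  have hle : edgeIdeal k E w ≤
      Ideal.span ((fun s => monomial s (1 : k)) '' Set.range fun y => Finsupp.single y (w y)) := by
    rw [edgeIdeal, Ideal.span_le]
    rintro _ ⟨e, -, rfl⟩
    refine Ideal.mul_mem_left _ _ (Ideal.subset_span ⟨_, ⟨e.2, rfl⟩, ?_⟩)
    rw [X_pow_eq_monomial]
  intro hmem
  have hmem' := hle hmem
  rw [hprod, mem_ideal_span_monomial_image] at hmem'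
  obtain ⟨_, ⟨y, rfl⟩, hy⟩ := hmem' (Finsupp.equivFunOnFinite.symm fun x => w x - 1)
    (by simp [mem_support_iff])
  have h₁ := hy y
  have h₂ := hw y
  simp at h₁
  omega

lemma X_mul_prod_X_pow_mem_edgeIdeal [Fintype V] {E : Set (V × V)} {w : V → ℕ}
    (hw : ∀ x, 2 ≤ w x) {x y : V} (hxy : x ≠ y) (h : (y, x) ∈ E) :
    X x * ∏ z, (X z : MvPolynomial V k) ^ (w z - 1) ∈ edgeIdeal k E w := by
  classical
  have hgen : (X y * X x ^ w x : MvPolynomial V k) ∈ edgeIdeal k E w :=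
    Ideal.subset_span ⟨_, h, rfl⟩
  refine Ideal.mem_of_dvd _ ?_ hgen
  rw [← Finset.mul_prod_erase _ _ (Finset.mem_univ x), ← mul_assoc, ← pow_succ',
    Nat.sub_add_cancel (by linarith [hw x]), mul_comm]
  refine mul_dvd_mul_left _ ((dvd_pow_self _ ?_).trans
    (Finset.dvd_prod_of_mem _ (Finset.mem_erase.2 ⟨hxy.symm, Finset.mem_univ y⟩)))
  have := hw y
  omega

end WOG

/-- **Corollary (complete tripartite, regularity).**
`D` is a vertex-weighted oriented complete tripartite graph: the vertex set
is partitioned into nonempty parts `V_1, V_2, V_3` (encoded by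
`part : V → Fin 3`), and the edges are exactly all pairs from `V_1` to `V_2`,
all pairs from `V_2` to `V_3` and all pairs from `V_3` to `V_1`.
All weights are `≥ 2`.  Then `pd I(D) = |V| - 1`. -/
theorem complete_tripartite_pd (k : Type) [Field k]
    (V : Type) [Fintype V] (part : V → Fin 3) (hpart : ∀ i : Fin 3, ∃ x : V, part x = i)
    (E : Set (V × V))
    (hE : E = {p : V × V | (part p.2 : ℕ) = ((part p.1 : ℕ) + 1) % 3})
    (w : V → ℕ) (hw2 : ∀ x : V, 2 ≤ w x)
    (R : WOG.MinFreeRes (WOG.edgeIdeal k E w)) :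
    IsGreatest R.pdSet (Fintype.card V - 1) := by
  have hcard : 2 ≤ Fintype.card V := by
    have := Fintype.card_le_of_surjective part hpart
    simp at this
    omega
  refine R.isGreatest_pdSet hcard
    (WOG.prod_X_pow_notMem_edgeIdeal E fun x => (by norm_num : 1 ≤ 2).trans (hw2 x))
    fun r hr => WOG.mul_mem_of_mem_mIdeal (fun x => ?_) hr
  obtain ⟨y, hy⟩ := hpart (part x + 2)
  have hyx : (part x : ℕ) = ((part y : ℕ) + 1) % 3 := by
    rw [hy]
    generalize part x = i
    revert i
    decide
  refine WOG.X_mul_prod_X_pow_mem_edgeIdeal hw2 (y := y) ?_ (hE ▸ hyx)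
  rintro rfl
  omega
end
end

section
/- Let I = J + K be a Betti splitting of a monomial ideal I in a polynomial ring S over a field, with J ∩ K ≠ 0. Then pd(I) = max{pd(J), pd(K), pd(J ∩ K) + 1}. -/
open MvPolynomial

noncomputable section

/-- `G` is the (unique) minimal monomial generating set of the monomial ideal
`I`: it consists of monomials, generates `I`, and no proper subset of it
generates `I`. -/
def IsMinimalMonomialGens {k : Type} [Field k] {V : Type}
    (I : Ideal (MvPolynomial V k)) (G : Finset (MvPolynomial V k)) : Prop :=
  (∀ g ∈ G, ∃ s : V →₀ ℕ, g = monomial s 1) ∧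
  Ideal.span (G : Set (MvPolynomial V k)) = I ∧
  ∀ G' : Finset (MvPolynomial V k), G' ⊂ G →
    Ideal.span (G' : Set (MvPolynomial V k)) ≠ I

/-- **(Betti splitting, regularity).**
Let `I = J + K` be monomial ideals in the polynomial ring `S` over a field
such that the minimal monomial generating set `G(I)` is the disjoint union of
`G(J)` and `G(K)`, suppose the decomposition is a Betti splitting, i.e.
`β_{i,j}(I) = β_{i,j}(J) + β_{i,j}(K) + β_{i-1,j}(J ∩ K)` for all `i, j ≥ 0`
(with the convention `β_{-1,j}(J ∩ K) = 0`), and suppose `J ∩ K ≠ 0`.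
Then `pd I = max {pd J, pd K, pd (J ∩ K) + 1}`. -/
theorem betti_splitting_pd (k : Type) [Field k] (V : Type) [Fintype V]
    (I J K : Ideal (MvPolynomial V k))
    (GI GJ GK : Finset (MvPolynomial V k))
    (hGI : IsMinimalMonomialGens I GI) (hGJ : IsMinimalMonomialGens J GJ)
    (hGK : IsMinimalMonomialGens K GK)
    (hsum : I = J + K)
    (hunion : (GI : Set (MvPolynomial V k)) = ↑GJ ∪ ↑GK)
    (hdisj : Disjoint GJ GK)
    (hJK : J ⊓ K ≠ ⊥)
    (RI : WOG.MinFreeRes I) (RJ : WOG.MinFreeRes J) (RK : WOG.MinFreeRes K)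
    (RJK : WOG.MinFreeRes (J ⊓ K))
    (hsplit : ∀ i j : ℕ, RI.betti i j =
      RJ.betti i j + RK.betti i j + (if i = 0 then 0 else RJK.betti (i - 1) j))
    (pJ pK pJK : ℕ)
    (hpJ : IsGreatest RJ.pdSet pJ) (hpK : IsGreatest RK.pdSet pK)
    (hpJK : IsGreatest RJK.pdSet pJK) :
    IsGreatest RI.pdSet (max (max pJ pK) (pJK + 1)) := by
  have hmem : ∀ i, i ∈ RI.pdSet ↔
      i ∈ RJ.pdSet ∨ i ∈ RK.pdSet ∨ ∃ m ∈ RJK.pdSet, i = m + 1 := by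
    intro i
    simp only [WOG.MinFreeRes.pdSet, Set.mem_ofPred_eq, hsplit]
    rcases i with _ | m
    · simp [← exists_or, imp_iff_not_or]
    · simp [← exists_or, imp_iff_not_or, or_assoc]
  constructor
  · rw [hmem]
    rcases max_choice (max pJ pK) (pJK + 1) with h | h <;> rw [h]
    · rcases max_choice pJ pK with h' | h' <;> rw [h']
      · exact Or.inl hpJ.1
      · exact Or.inr (Or.inl hpK.1)
    · exact Or.inr (Or.inr ⟨pJK, hpJK.1, rfl⟩)
  · intro i hi
    rcases (hmem i).1 hi with h | h | ⟨m, hm, rfl⟩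
    · exact le_max_of_le_left (le_max_of_le_left (hpJ.2 h))
    · exact le_max_of_le_left (le_max_of_le_right (hpK.2 h))
    · exact le_max_of_le_right (Nat.succ_le_succ (hpJK.2 hm))
end
end
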